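/- Let (X, ℝ, α) be a periodic one-parameter C*-dynamical system with X_n ≠ {0} for some n ≠ 0. Then Condition 4.3 (in its periodic form) holds if and only if Condition (S) holds. -/

import Mathlib

open MeasureTheory Set Filter Topology Pointwise

noncomputable section

namespace PeligradMax

variable {X : Type*} [NonUnitalNormedRing X] [StarRing X] [CStarRing X]
  [NormedSpace ℂ X] [IsScalarTower ℂ X X] [SMulCommClass ℂ X X] [StarModule ℂ X]
  [CompleteSpace X] [PartialOrder X] [StarOrderedRing X]

/-- A one-parameter C*-dynamical system: a group of *-automorphisms of `X`
with norm-continuous orbit maps. -/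
structure IsCStarDynSys (α : ℝ → X → X) : Prop where
  map_zero_time : ∀ x, α 0 x = x
  map_add_time : ∀ s t x, α (s + t) x = α s (α t x)
  map_add : ∀ t x y, α t (x + y) = α t x + α t y
  map_smulc : ∀ (t : ℝ) (c : ℂ) (x : X), α t (c • x) = c • α t x
  map_mul : ∀ t x y, α t (x * y) = α t x * α t y
  map_star : ∀ t x, α t (star x) = star (α t x)
  continuous_orbit : ∀ x, Continuous fun t => α t x

/-- Closed linear span. -/
def ClosedSpan (S : Set X) : Set X := closure ((Submodule.span ℂ S : Submodule ℂ X) : Set X)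

def MulSet2 (S T : Set X) : Set X := {z | ∃ s ∈ S, ∃ t ∈ T, z = s * t}

def MulSet3 (S T R : Set X) : Set X := {z | ∃ s ∈ S, ∃ t ∈ T, ∃ r ∈ R, z = s * t * r}

/-- Fourier transform of an integrable function. -/
def fourierT (f : ℝ → ℂ) (γ : ℝ) : ℂ := ∫ t : ℝ, f t * Complex.exp (-(Complex.I * γ * t))

/-- `α_f(x) = ∫ f(t) α_t(x) dt`. -/
def smear (α : ℝ → X → X) (f : ℝ → ℂ) (x : X) : X := ∫ t : ℝ, f t • α t x

/-- Arveson spectrum of an element. -/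
def elemSpec (α : ℝ → X → X) (x : X) : Set ℝ :=
  {γ | ∀ f : ℝ → ℂ, Integrable f → smear α f x = 0 → fourierT f γ = 0}

/-- Spectral subspace associated with a closed set `F ⊆ ℝ`. -/
def specC (α : ℝ → X → X) (F : Set ℝ) : Set X := {x | elemSpec α x ⊆ F}

/-- Spectral subspace of the subset `S` associated with an open set `U ⊆ ℝ`. -/
def specO (α : ℝ → X → X) (S : Set X) (U : Set ℝ) : Set X :=
  ClosedSpan {y | ∃ x ∈ S, ∃ f : ℝ → ℂ, Integrable f ∧
    IsCompact (tsupport (fourierT f)) ∧ tsupport (fourierT f) ⊆ U ∧ y = smear α f x}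

/-- The fixed point algebra `X^α`. -/
def fixedPts (α : ℝ → X → X) : Set X := {x | ∀ t, α t x = x}

/-- The Arveson spectrum of the action restricted to `S`. -/
def actSpec (α : ℝ → X → X) (S : Set X) : Set ℝ :=
  {γ : ℝ | ∀ ε > (0 : ℝ), S ∩ specC α (Icc (γ - ε) (γ + ε)) ≠ ({0} : Set X)}

def Invariant (α : ℝ → X → X) (S : Set X) : Prop := ∀ t : ℝ, ∀ x ∈ S, α t x ∈ S

def IsSubalgebra (B : Set X) : Prop :=
  (0 : X) ∈ B ∧ (∀ x ∈ B, ∀ y ∈ B, x + y ∈ B) ∧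
  (∀ c : ℂ, ∀ x ∈ B, c • x ∈ B) ∧ ∀ x ∈ B, ∀ y ∈ B, x * y ∈ B

def IsStarSubalgebra (B : Set X) : Prop := IsSubalgebra B ∧ ∀ x ∈ B, star x ∈ B

/-- `B` is a hereditary C*-subalgebra of the subset `S`. -/
def IsHereditaryIn (S B : Set X) : Prop :=
  B ⊆ S ∧ IsClosed B ∧ IsStarSubalgebra B ∧
  ∀ x ∈ S, ∀ b ∈ B, 0 ≤ x → x ≤ b → x ∈ B

/-- `K` is a norm-closed two-sided ideal of the subset `S`. -/
def IsClosedTwoSidedIdealIn (S K : Set X) : Prop :=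
  K ⊆ S ∧ IsClosed K ∧ (0 : X) ∈ K ∧ (∀ x ∈ K, ∀ y ∈ K, x + y ∈ K) ∧
  (∀ c : ℂ, ∀ x ∈ K, c • x ∈ K) ∧ ∀ s ∈ S, ∀ k ∈ K, s * k ∈ K ∧ k * s ∈ K

/-- `S` is `α`-simple: no nontrivial norm-closed `α`-invariant two-sided ideals. -/
def AlphaSimple (α : ℝ → X → X) (S : Set X) : Prop :=
  ∀ K : Set X, IsClosedTwoSidedIdealIn S K → Invariant α K → K = ({0} : Set X) ∨ K = S

/-- The strong Arveson spectrum of the action restricted to `B`. -/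
def strongSpec (α : ℝ → X → X) (B : Set X) : Set ℝ :=
  {γ : ℝ | ∀ ε > (0 : ℝ),
    ClosedSpan (MulSet3 (star '' (B ∩ specC α (Icc (γ - ε) (γ + ε)))) B
      (B ∩ specC α (Icc (γ - ε) (γ + ε)))) = B}

/-- The strong Connes spectrum of the action restricted to `S`. -/
def ConnesSpec (α : ℝ → X → X) (S : Set X) : Set ℝ :=
  ⋂ B ∈ {B : Set X | IsHereditaryIn S B ∧ B ≠ ({0} : Set X) ∧ Invariant α B},
    strongSpec α B

def IsMaximalClosedSubalgebra (B : Set X) : Prop :=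
  IsClosed B ∧ IsSubalgebra B ∧ B ≠ (univ : Set X) ∧
  ∀ W : Set X, IsClosed W → IsSubalgebra W → B ⊆ W → W = B ∨ W = univ

/-- The spectral Condition 4.3. -/
def Condition43 (α : ℝ → X → X) : Prop :=
  (∃ γ₀ : ℝ, 0 < γ₀ ∧ actSpec α (univ : Set X) = ({-γ₀, 0, γ₀} : Set ℝ) ∧
    IsClosedTwoSidedIdealIn (fixedPts α)
      (ClosedSpan (MulSet2 (specC α ({γ₀} : Set ℝ)) (star '' specC α ({γ₀} : Set ℝ)))) ∧
    ∀ K : Set X,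
      IsClosedTwoSidedIdealIn
        (ClosedSpan (MulSet2 (specC α ({γ₀} : Set ℝ)) (star '' specC α ({γ₀} : Set ℝ)))) K →
      K = ({0} : Set X) ∨
        K = ClosedSpan (MulSet2 (specC α ({γ₀} : Set ℝ)) (star '' specC α ({γ₀} : Set ℝ)))) ∨
  (∃ Y : Set X, IsClosedTwoSidedIdealIn (univ : Set X) Y ∧ Invariant α Y ∧ AlphaSimple α Y ∧
    specO α Y (Ioi (0 : ℝ)) = specO α (univ : Set X) (Ioi (0 : ℝ)) ∧
    actSpec α Y = ConnesSpec α Y ∧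
    closure (Y + specC α (Ici (0 : ℝ))) = (univ : Set X))

/-- The spectral subspace `X_n` of a periodic system with period `2π/γ₁`. -/
def specZ (α : ℝ → X → X) (γ₁ : ℝ) (n : ℤ) : Set X :=
  {x | ∀ t : ℝ, α t x = Complex.exp (Complex.I * (((n : ℝ) * γ₁ * t : ℝ) : ℂ)) • x}

/-- Condition (S) for a periodic system. -/
def ConditionS (α : ℝ → X → X) (γ₁ : ℝ) : Prop :=
  ∃ J : Set X, IsClosedTwoSidedIdealIn (specZ α γ₁ 0) J ∧
    (∀ K : Set X, IsClosedTwoSidedIdealIn J K → K = ({0} : Set X) ∨ K = J) ∧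
    ∀ n : ℤ, 0 < n → specZ α γ₁ n ≠ ({0} : Set X) →
      ClosedSpan {z : X | ∃ x ∈ specZ α γ₁ n, ∃ y ∈ specZ α γ₁ n, z = x * star y} = J

/-- The periodic form of Condition 4.3. -/
def Condition43Periodic (α : ℝ → X → X) (γ₁ : ℝ) : Prop :=
  (∃ m : ℤ, 0 < m ∧ {n : ℤ | specZ α γ₁ n ≠ ({0} : Set X)} = ({-m, 0, m} : Set ℤ) ∧
    IsClosedTwoSidedIdealIn (specZ α γ₁ 0)
      (ClosedSpan {z : X | ∃ x ∈ specZ α γ₁ m, ∃ y ∈ specZ α γ₁ m, z = x * star y}) ∧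
    ∀ K : Set X,
      IsClosedTwoSidedIdealIn
        (ClosedSpan {z : X | ∃ x ∈ specZ α γ₁ m, ∃ y ∈ specZ α γ₁ m, z = x * star y}) K →
      K = ({0} : Set X) ∨
        K = ClosedSpan {z : X | ∃ x ∈ specZ α γ₁ m, ∃ y ∈ specZ α γ₁ m, z = x * star y}) ∨
  (∃ Y : Set X, IsClosedTwoSidedIdealIn (univ : Set X) Y ∧ Invariant α Y ∧
    (∀ K : Set X, IsClosedTwoSidedIdealIn Y K → Invariant α K →
      K = ({0} : Set X) ∨ K = Y) ∧
    ClosedSpan (⋃ n ∈ Ici (1 : ℤ), Y ∩ specZ α γ₁ n) =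
      ClosedSpan (⋃ n ∈ Ici (1 : ℤ), specZ α γ₁ n) ∧
    {n : ℤ | Y ∩ specZ α γ₁ n ≠ ({0} : Set X)} =
      {n : ℤ | ∀ Z : Set X, IsHereditaryIn Y Z → Invariant α Z → Z ≠ ({0} : Set X) →
        ClosedSpan (MulSet3 (star '' (Z ∩ specZ α γ₁ n)) Z (Z ∩ specZ α γ₁ n)) = Z} ∧
    closure (Y + ClosedSpan (⋃ n ∈ Ici (0 : ℤ), specZ α γ₁ n)) = (univ : Set X))

set_option linter.unusedSectionVars false

section CStarAlgebraFacts

variable {A : Type*} [NonUnitalCStarAlgebra A] [PartialOrder A] [StarOrderedRing A]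

/-- A closed star-subalgebra containing a dominating element for `star x * x` contains approximate
right units for `x`. -/
theorem exists_norm_sub_mul_lt {B : NonUnitalStarSubalgebra ℂ A} (hB : IsClosed (B : Set A))
    {x b : A} (hb : b ∈ B) (hxb : star x * x ≤ b) {ε : ℝ} (hε : 0 < ε) :
    ∃ e ∈ B, ‖x - x * e‖ < ε := by
  have hb0 : 0 ≤ b := (star_mul_self_nonneg x).trans hxb
  obtain ⟨δ, hδ, hδε⟩ : ∃ δ : ℝ, 0 < δ ∧ 2 * δ < ε ^ 2 :=
    ⟨ε ^ 2 / 4, by positivity, by nlinarith [pow_pos hε 2]⟩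
  have hspec : ∀ t ∈ quasispectrum ℝ b, 0 ≤ t :=
    fun t ht => quasispectrum_nonneg_of_nonneg b hb0 t ht
  set f : ℝ → ℝ := fun t => t / (δ + t) with hf
  have hfc : ContinuousOn f (quasispectrum ℝ b) := by
    refine continuousOn_id.div (by fun_prop) fun t ht => ?_
    have := hspec t ht
    simp only [ne_eq]
    linarith
  have hf0 : f 0 = 0 := by simp [hf]
  set e : A := cfcₙ f b with he
  have heB : e ∈ B := by
    have := hB
    exact cfcₙ_mem (𝕜' := ℂ) f hb
  have hesa : star e = e := (cfcₙ_predicate f b : IsSelfAdjoint e)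
  have he1 : ‖e‖ ≤ 1 := by
    refine norm_cfcₙ_le fun t ht => ?_
    have := hspec t ht
    rw [Real.norm_eq_abs, abs_of_nonneg (by positivity), div_le_one (by positivity)]
    linarith
  have hbe : ‖b - b * e‖ ≤ δ := by
    have h1 : b - b * e = cfcₙ (fun t => t - t * f t) b := by
      rw [cfcₙ_sub (fun t => t) (fun t => t * f t) b, cfcₙ_mul (fun t => t) f b, cfcₙ_id' ℝ b]
    rw [h1]
    refine norm_cfcₙ_le fun t ht => ?_
    have := hspec t ht
    have h2 : t - t * f t = δ * (t / (δ + t)) := by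
      simp only [hf]
      field_simp
      ring
    have h3 : t / (δ + t) ≤ 1 := by
      rw [div_le_one (by positivity)]
      linarith
    rw [h2, Real.norm_eq_abs, abs_of_nonneg (by positivity)]
    nlinarith
  refine ⟨e, heB, ?_⟩
  obtain ⟨c, hc⟩ := CStarAlgebra.nonneg_iff_eq_star_mul_self.1 (sub_nonneg.2 hxb)
  have hle : star (x - x * e) * (x - x * e) ≤ (b - b * e) - e * (b - b * e) := by
    rw [← sub_nonneg]
    convert star_mul_self_nonneg (c - c * e) using 1
    have h4 : b = star x * x + star c * c := by rw [← hc]; abel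
    simp only [star_sub, star_mul, hesa]
    rw [h4]
    noncomm_ring
  have h5 : ‖x - x * e‖ ^ 2 < ε ^ 2 := by
    rw [pow_two, ← CStarRing.norm_star_mul_self]
    calc _ ≤ ‖(b - b * e) - e * (b - b * e)‖ :=
          CStarAlgebra.norm_le_norm_of_nonneg_of_le (star_mul_self_nonneg _) hle
      _ ≤ ‖b - b * e‖ + ‖e‖ * ‖b - b * e‖ :=
          (norm_sub_le _ _).trans (by gcongr; exact norm_mul_le _ _)
      _ ≤ δ + 1 * δ := by gcongr
      _ < ε ^ 2 := by linarith
  exact lt_of_pow_lt_pow_left₀ 2 hε.le h5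

end CStarAlgebraFacts

/-- The bundled C⋆-algebra structure carried by `X`. -/
abbrev toNonUnitalCStarAlgebra (X : Type*) [NonUnitalNormedRing X] [StarRing X] [CStarRing X]
    [NormedSpace ℂ X] [IsScalarTower ℂ X X] [SMulCommClass ℂ X X] [StarModule ℂ X]
    [CompleteSpace X] : NonUnitalCStarAlgebra X where

theorem mem_of_star_mul_self_le_of_mul_mem {B T : Set X} (hBc : IsClosed B)
    (hB : IsStarSubalgebra B) (hT : IsClosed T) {x b : X} (hb : b ∈ B) (hxb : star x * x ≤ b)
    (h : ∀ e ∈ B, x * e ∈ T) : x ∈ T := by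
  let _ := toNonUnitalCStarAlgebra X
  let B' : NonUnitalStarSubalgebra ℂ X :=
    { carrier := B
      zero_mem' := hB.1.1
      add_mem' := fun ha hb => hB.1.2.1 _ ha _ hb
      mul_mem' := fun ha hb => hB.1.2.2.2 _ ha _ hb
      smul_mem' := fun c _ hx => hB.1.2.2.1 c _ hx
      star_mem' := fun hx => hB.2 _ hx }
  rw [← hT.closure_eq, Metric.mem_closure_iff]
  intro ε hε
  obtain ⟨e, he, hlt⟩ := exists_norm_sub_mul_lt (B := B') hBc hb hxb hε
  exact ⟨x * e, h e he, by rwa [dist_eq_norm]⟩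

theorem mem_of_mul_mem {B T : Set X} (hBc : IsClosed B) (hB : IsStarSubalgebra B)
    (hT : IsClosed T) {x : X} (hx : star x * x ∈ B) (h : ∀ e ∈ B, x * e ∈ T) : x ∈ T :=
  mem_of_star_mul_self_le_of_mul_mem hBc hB hT hx le_rfl h

theorem mem_of_mul_mem_left {B T : Set X} (hBc : IsClosed B) (hB : IsStarSubalgebra B)
    (hT : IsClosed T) {x : X} (hx : x * star x ∈ B) (h : ∀ e ∈ B, e * x ∈ T) : x ∈ T := by
  have : star x ∈ star ⁻¹' T := by
    refine mem_of_mul_mem hBc hB (hT.preimage continuous_star) (by simpa using hx) fun e he => ?_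
    simpa using h (star e) (hB.2 e he)
  simpa using this

theorem mem_of_mul_mul_mem {B T : Set X} (hBc : IsClosed B) (hB : IsStarSubalgebra B)
    (hT : IsClosed T) {x : X} (hx : star x * x ∈ B) (hx' : x * star x ∈ B)
    (h : ∀ d ∈ B, ∀ e ∈ B, d * x * e ∈ T) : x ∈ T := by
  refine mem_of_mul_mem hBc hB hT hx fun e he => ?_
  refine mem_of_mul_mem_left (T := {y | y * e ∈ T}) hBc hB
    (hT.preimage (by fun_prop)) hx' fun d hd => h d hd e he

theorem isStarSubalgebra_inter_star {L : Set X} (hL : IsSubalgebra L) :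
    IsStarSubalgebra {x | x ∈ L ∧ star x ∈ L} := by
  obtain ⟨h0, hadd, hsmul, hmul⟩ := hL
  refine ⟨⟨⟨h0, by simpa using h0⟩, ?_, ?_, ?_⟩, ?_⟩
  · rintro x ⟨hx, hx'⟩ y ⟨hy, hy'⟩
    exact ⟨hadd _ hx _ hy, by simpa using hadd _ hx' _ hy'⟩
  · rintro c x ⟨hx, hx'⟩
    exact ⟨hsmul _ _ hx, by simpa using hsmul (star c) _ hx'⟩
  · rintro x ⟨hx, hx'⟩ y ⟨hy, hy'⟩
    exact ⟨hmul _ hx _ hy, by simpa using hmul _ hy' _ hx'⟩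
  · rintro x ⟨hx, hx'⟩
    exact ⟨hx', by simpa using hx⟩

/-- A hereditary subalgebra of a two-sided ideal `S` absorbs elements between its own elements. -/
theorem IsHereditaryIn.mul_mul_mem {S B : Set X} (hS : IsClosedTwoSidedIdealIn univ S)
    (hB : IsHereditaryIn S B) {b c : X} (hb : b ∈ B) (hc : c ∈ B) (y : X) : b * y * c ∈ B := by
  let _ := toNonUnitalCStarAlgebra X
  obtain ⟨hBS, hBc, ⟨⟨h0, hadd, hsmul, hmul⟩, hstar⟩, hher⟩ := hB
  have hneg : ∀ x ∈ B, -x ∈ B := fun x hx => by simpa using hsmul (-1) x hx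
  have key : ∀ y : X, 0 ≤ y → ∀ d ∈ B, d * y * star d ∈ B := by
    intro y hy d hd
    refine hher _ ?_ ((‖y‖ : ℂ) • (d * star d)) (hsmul _ _ (hmul _ hd _ (hstar _ hd)))
      (star_right_conjugate_nonneg hy d) ?_
    · exact (hS.2.2.2.2.2 _ (mem_univ _) _ ((hS.2.2.2.2.2 _ (mem_univ y) _ (hBS hd)).2)).2
    · have := CStarAlgebra.star_right_conjugate_le_norm_smul (a := d) (b := y)
        (IsSelfAdjoint.of_nonneg hy)
      simpa using this
  have key2 : ∀ y : X, 0 ≤ y → ∀ d ∈ B, ∀ e ∈ B, d * y * e ∈ B := by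
    intro y hy d hd e he
    have he' := hstar _ he
    have h4 : (4 : ℂ) • (d * y * e) =
        ((d + star e) * y * star (d + star e) + -((d + -star e) * y * star (d + -star e))) +
        Complex.I • ((d + Complex.I • star e) * y * star (d + Complex.I • star e) +
          -((d + (-Complex.I) • star e) * y * star (d + (-Complex.I) • star e))) := by
      simp only [star_add, star_star, star_neg, star_smul, mul_add, add_mul, mul_smul_comm,
        smul_mul_assoc, smul_add, smul_smul, neg_mul, mul_neg, smul_neg, neg_smul]
      simp
      module
    have h5 : d * y * e = (1 / 4 : ℂ) • ((4 : ℂ) • (d * y * e)) := by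
      rw [smul_smul]; norm_num
    rw [h5]
    refine hsmul _ _ ?_
    rw [h4]
    refine hadd _ (hadd _ (key y hy _ (hadd _ hd _ he')) _ (hneg _ ?_)) _
      (hsmul _ _ (hadd _ (key y hy _ ?_) _ (hneg _ (key y hy _ ?_))))
    · exact key y hy _ (hadd _ hd _ (hneg _ he'))
    · exact hadd _ hd _ (hsmul _ _ he')
    · exact hadd _ hd _ (hsmul _ _ he')
  have hy : y ∈ Submodule.span ℂ {a : X | 0 ≤ a} := by
    rw [CStarAlgebra.span_nonneg]
    trivial
  induction hy using Submodule.span_induction with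
  | mem x hx => exact key2 x hx b hb c hc
  | zero => simpa using h0
  | add x y _ _ hx hy => rw [mul_add, add_mul]; exact hadd _ hx _ hy
  | smul r x _ hx => rw [mul_smul_comm, smul_mul_assoc]; exact hsmul _ _ hx

/-- The intersection of a closed left ideal with its adjoint is hereditary. -/
theorem isHereditaryIn_inter_star {S L : Set X} (hLS : L ⊆ S) (hLc : IsClosed L)
    (h0 : (0 : X) ∈ L) (hadd : ∀ x ∈ L, ∀ y ∈ L, x + y ∈ L)
    (hsmul : ∀ c : ℂ, ∀ x ∈ L, c • x ∈ L) (hmul : ∀ y : X, ∀ x ∈ L, y * x ∈ L) :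
    IsHereditaryIn S {x | x ∈ L ∧ star x ∈ L} := by
  let _ := toNonUnitalCStarAlgebra X
  have hcl : IsClosed {x | x ∈ L ∧ star x ∈ L} :=
    hLc.inter (hLc.preimage continuous_star)
  have halg : IsStarSubalgebra {x | x ∈ L ∧ star x ∈ L} :=
    isStarSubalgebra_inter_star ⟨h0, hadd, hsmul, fun x _ y hy => hmul x y hy⟩
  refine ⟨fun x hx => hLS hx.1, hcl, halg, ?_⟩
  intro x _ b hb hx hxb
  have hsq : star (CFC.sqrt x) * CFC.sqrt x = x := by
    rw [(IsSelfAdjoint.of_nonneg (CFC.sqrt_nonneg x)).star_eq, CFC.sqrt_mul_sqrt_self x]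
  have hs : CFC.sqrt x ∈ L :=
    mem_of_star_mul_self_le_of_mul_mem hcl halg hLc hb (hsq.trans_le hxb) fun e he =>
      hmul _ _ he.1
  have hxL : x ∈ L := by
    rw [← hsq]
    exact hmul _ _ hs
  exact ⟨hxL, by rwa [(IsSelfAdjoint.of_nonneg hx).star_eq]⟩

/-- A closed two-sided ideal in a star-closed set is star-closed. -/
theorem IsClosedTwoSidedIdealIn.star_mem {S K : Set X} (hS : ∀ x ∈ S, star x ∈ S)
    (hK : IsClosedTwoSidedIdealIn S K) {x : X} (hx : x ∈ K) : star x ∈ K := by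
  obtain ⟨hKS, hc, h0, hadd, hsmul, hmul⟩ := hK
  have hcl : IsClosed {x | x ∈ K ∧ star x ∈ K} := hc.inter (hc.preimage continuous_star)
  have halg : IsStarSubalgebra {x | x ∈ K ∧ star x ∈ K} :=
    isStarSubalgebra_inter_star ⟨h0, hadd, hsmul, fun x hx y hy => (hmul x (hKS hx) y hy).1⟩
  have hxx : star x * x ∈ K := (hmul _ (hS _ (hKS hx)) _ hx).1
  refine mem_of_mul_mem_left hcl halg hc (x := star x) ?_ fun e he =>
    (hmul _ (hS _ (hKS hx)) _ he.1).2
  simpa using hxx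

/-- A norm-closed linear subspace. -/
structure IsClosedSubspace (S : Set X) : Prop where
  isClosed : IsClosed S
  zero_mem : (0 : X) ∈ S
  add_mem : ∀ x ∈ S, ∀ y ∈ S, x + y ∈ S
  smul_mem : ∀ c : ℂ, ∀ x ∈ S, c • x ∈ S

namespace IsClosedSubspace

variable {S T : Set X}

/-- A closed subspace as a submodule. -/
def toSubmodule (hS : IsClosedSubspace S) : Submodule ℂ X where
  carrier := S
  zero_mem' := hS.zero_mem
  add_mem' := fun hx hy => hS.add_mem _ hx _ hy
  smul_mem' := fun c _ hx => hS.smul_mem c _ hx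

theorem closedSpan (S : Set X) : IsClosedSubspace (ClosedSpan S) where
  isClosed := isClosed_closure
  zero_mem := (Submodule.span ℂ S).topologicalClosure.zero_mem
  add_mem := fun _ hx _ hy => (Submodule.span ℂ S).topologicalClosure.add_mem hx hy
  smul_mem := fun c _ hx => (Submodule.span ℂ S).topologicalClosure.smul_mem c hx

theorem closedSpan_subset (hT : IsClosedSubspace T) (h : S ⊆ T) : ClosedSpan S ⊆ T :=
  closure_minimal (Submodule.span_le (p := hT.toSubmodule).2 h) hT.isClosed

theorem inter (hS : IsClosedSubspace S) (hT : IsClosedSubspace T) : IsClosedSubspace (S ∩ T) where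
  isClosed := hS.isClosed.inter hT.isClosed
  zero_mem := ⟨hS.zero_mem, hT.zero_mem⟩
  add_mem := fun _ hx _ hy => ⟨hS.add_mem _ hx.1 _ hy.1, hT.add_mem _ hx.2 _ hy.2⟩
  smul_mem := fun c _ hx => ⟨hS.smul_mem c _ hx.1, hT.smul_mem c _ hx.2⟩

theorem iInter {ι : Sort*} {S : ι → Set X} (hS : ∀ i, IsClosedSubspace (S i)) :
    IsClosedSubspace {x | ∀ i, x ∈ S i} where
  isClosed := by
    simp only [ofPred_forall]
    exact isClosed_iInter fun i => (hS i).isClosed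
  zero_mem := fun i => (hS i).zero_mem
  add_mem := fun _ hx _ hy i => (hS i).add_mem _ (hx i) _ (hy i)
  smul_mem := fun c _ hx i => (hS i).smul_mem c _ (hx i)

theorem preimage (hT : IsClosedSubspace T) (f : X →L[ℂ] X) : IsClosedSubspace {x | f x ∈ T} where
  isClosed := hT.isClosed.preimage f.continuous
  zero_mem := by simpa using hT.zero_mem
  add_mem := fun x hx y hy => by simpa using hT.add_mem _ hx _ hy
  smul_mem := fun c x hx => by simpa using hT.smul_mem c _ hx

theorem mul_left (hT : IsClosedSubspace T) (a : X) : IsClosedSubspace {x | a * x ∈ T} :=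
  hT.preimage (ContinuousLinearMap.mul ℂ X a)

theorem mul_right (hT : IsClosedSubspace T) (b : X) : IsClosedSubspace {x | x * b ∈ T} :=
  hT.preimage ((ContinuousLinearMap.mul ℂ X).flip b)

theorem star (hT : IsClosedSubspace T) : IsClosedSubspace {x | star x ∈ T} where
  isClosed := hT.isClosed.preimage continuous_star
  zero_mem := by simpa using hT.zero_mem
  add_mem := fun x hx y hy => by simpa using hT.add_mem _ hx _ hy
  smul_mem := fun c x hx => by simpa using hT.smul_mem (Star.star c) _ hx

theorem convex (hS : IsClosedSubspace S) : Convex ℝ S :=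
  (hS.toSubmodule.restrictScalars ℝ).convex

theorem singleton_zero : IsClosedSubspace ({0} : Set X) where
  isClosed := isClosed_singleton
  zero_mem := rfl
  add_mem := by simp
  smul_mem := by simp

/-- Hahn–Banach: a vector annihilated by all functionals vanishing on a closed subspace
lies in the subspace. -/
theorem mem_of_forall_dual (hS : IsClosedSubspace S) {x : X}
    (h : ∀ φ : X →L[ℂ] ℂ, (∀ y ∈ S, φ y = 0) → φ x = 0) : x ∈ S := by
  by_contra hx
  have : IsClosed (hS.toSubmodule : Set X) := hS.isClosed
  have hne : ‖hS.toSubmodule.mkQ x‖ ≠ 0 := by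
    rw [norm_ne_zero_iff, ne_eq, Submodule.mkQ_apply, Submodule.Quotient.mk_eq_zero]
    exact hx
  obtain ⟨g, -, hg⟩ := exists_dual_vector ℂ (hS.toSubmodule.mkQ x) hne
  have := h (g.comp hS.toSubmodule.mkQL) fun y hy => by
    have : hS.toSubmodule.mkQ y = 0 := by
      rw [Submodule.mkQ_apply, Submodule.Quotient.mk_eq_zero]
      exact hy
    simp only [ContinuousLinearMap.comp_apply]
    exact (congrArg g this).trans (map_zero g)
  refine hne ?_
  have h2 : g (hS.toSubmodule.mkQ x) = 0 := this
  rw [hg] at h2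
  exact RCLike.ofReal_eq_zero.1 h2

end IsClosedSubspace

theorem subset_closedSpan (S : Set X) : S ⊆ ClosedSpan S :=
  Submodule.subset_span.trans subset_closure

theorem IsClosedTwoSidedIdealIn.isClosedSubspace {S K : Set X}
    (hK : IsClosedTwoSidedIdealIn S K) : IsClosedSubspace K :=
  ⟨hK.2.1, hK.2.2.1, hK.2.2.2.1, hK.2.2.2.2.1⟩

theorem ne_singleton_zero_iff {S : Set X} (h0 : (0 : X) ∈ S) :
    S ≠ {0} ↔ ∃ x ∈ S, x ≠ 0 := by
  constructor
  · intro h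
    by_contra! hc
    exact h (Subset.antisymm (fun x hx => hc x hx) (by simpa using h0))
  · rintro ⟨x, hx, hx0⟩ rfl
    exact hx0 hx

section Dynamics

variable {α : ℝ → X → X} {γ₁ : ℝ}

namespace IsCStarDynSys

/-- The automorphism `α t` as a star homomorphism. -/
def toStarHom (hα : IsCStarDynSys α) (t : ℝ) : X →⋆ₙₐ[ℂ] X where
  toFun := α t
  map_smul' := hα.map_smulc t
  map_zero' := by simpa using hα.map_smulc t 0 0
  map_add' := hα.map_add t
  map_mul' := hα.map_mul t
  map_star' := hα.map_star t

theorem norm_map_le (hα : IsCStarDynSys α) (t : ℝ) (x : X) : ‖α t x‖ ≤ ‖x‖ :=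
  let _ := toNonUnitalCStarAlgebra X
  NonUnitalStarAlgHom.norm_apply_le (hα.toStarHom t) x

/-- The automorphism `α t` as a continuous linear map. -/
def toCLM (hα : IsCStarDynSys α) (t : ℝ) : X →L[ℂ] X :=
  LinearMap.mkContinuous
    { toFun := α t
      map_add' := hα.map_add t
      map_smul' := hα.map_smulc t } 1 fun x => by simpa using hα.norm_map_le t x

@[simp]
theorem toCLM_apply (hα : IsCStarDynSys α) (t : ℝ) (x : X) : hα.toCLM t x = α t x := rfl

theorem isClosedSubspace_specZ (hα : IsCStarDynSys α) (γ₁ : ℝ) (n : ℤ) :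
    IsClosedSubspace (specZ α γ₁ n) :=
  IsClosedSubspace.iInter (S := fun t => {x : X | α t x =
    Complex.exp (Complex.I * (((n : ℝ) * γ₁ * t : ℝ) : ℂ)) • x}) fun t => by
    simpa [sub_eq_zero] using IsClosedSubspace.singleton_zero.preimage
      (hα.toCLM t - Complex.exp (Complex.I * (((n : ℝ) * γ₁ * t : ℝ) : ℂ)) •
        ContinuousLinearMap.id ℂ X)

theorem mul_mem_specZ (hα : IsCStarDynSys α) {m n : ℤ} {x y : X} (hx : x ∈ specZ α γ₁ m)
    (hy : y ∈ specZ α γ₁ n) : x * y ∈ specZ α γ₁ (m + n) := by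
  intro t
  rw [hα.map_mul, hx t, hy t, smul_mul_smul_comm, ← Complex.exp_add]
  congr 2
  push_cast
  ring

theorem star_mem_specZ (hα : IsCStarDynSys α) {n : ℤ} {x : X} (hx : x ∈ specZ α γ₁ n) :
    star x ∈ specZ α γ₁ (-n) := by
  intro t
  rw [hα.map_star, hx t, star_smul]
  congr 1
  rw [Complex.star_def, ← Complex.exp_conj]
  congr 1
  simp

theorem star_mem_specZ_neg (hα : IsCStarDynSys α) {n : ℤ} {x : X} (hx : x ∈ specZ α γ₁ (-n)) :
    star x ∈ specZ α γ₁ n := by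
  simpa using hα.star_mem_specZ hx

theorem invariant_specZ (hα : IsCStarDynSys α) (n : ℤ) : Invariant α (specZ α γ₁ n) := by
  intro t x hx
  rw [hx t]
  exact (hα.isClosedSubspace_specZ γ₁ n).smul_mem _ _ hx

theorem invariant_closedSpan (hα : IsCStarDynSys α) {S : Set X} (hS : Invariant α S) :
    Invariant α (ClosedSpan S) := fun t =>
  ((IsClosedSubspace.closedSpan S).preimage (hα.toCLM t)).closedSpan_subset
    fun _ hx => subset_closedSpan S (hS t _ hx)

theorem isStarSubalgebra_specZ_zero (hα : IsCStarDynSys α) (γ₁ : ℝ) :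
    IsStarSubalgebra (specZ α γ₁ 0) := by
  have h := hα.isClosedSubspace_specZ γ₁ 0
  exact ⟨⟨h.zero_mem, h.add_mem, h.smul_mem, fun x hx y hy => by
    simpa using hα.mul_mem_specZ hx hy⟩, fun x hx => by simpa using hα.star_mem_specZ hx⟩

end IsCStarDynSys

theorem specZ_inter_zero (hγ₁ : 0 < γ₁) {n : ℤ} (hn : n ≠ 0) {x : X}
    (hx : x ∈ specZ α γ₁ n) (hx0 : x ∈ specZ α γ₁ 0) : x = 0 := by
  have hn' : (n : ℝ) ≠ 0 := by exact_mod_cast hn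
  have h1 := hx (Real.pi / (n * γ₁))
  have h2 : (n : ℝ) * γ₁ * (Real.pi / (n * γ₁)) = Real.pi := by field_simp
  rw [h2, mul_comm Complex.I, Complex.exp_pi_mul_I, hx0] at h1
  have h3 : x = -x := by simpa using h1
  have h4 : (2 : ℂ) • x = 0 := by rw [two_smul]; nth_rewrite 2 [h3]; exact add_neg_cancel x
  exact (smul_eq_zero.1 h4).resolve_left two_ne_zero

/-- The lift of an orbit map of a periodic action to the circle. -/
def orbitCircle (hper : ∀ x : X, α (2 * Real.pi / γ₁) x = x) (hα : IsCStarDynSys α) (x : X) :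
    AddCircle (2 * Real.pi / γ₁) → X :=
  Function.Periodic.lift (f := fun t => α t x) fun t => by
    change α (t + 2 * Real.pi / γ₁) x = α t x
    rw [hα.map_add_time, hper]

section Circle

variable (hper : ∀ x : X, α (2 * Real.pi / γ₁) x = x) (hα : IsCStarDynSys α)

@[simp]
theorem orbitCircle_coe (x : X) (t : ℝ) : orbitCircle hper hα x t = α t x := rfl

theorem continuous_orbitCircle (x : X) : Continuous (orbitCircle hper hα x) :=
  continuous_coinduced_dom.2 (hα.continuous_orbit x)

theorem exists_orbitCircle (t : AddCircle (2 * Real.pi / γ₁)) :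
    ∃ s : ℝ, (s : AddCircle (2 * Real.pi / γ₁)) = t := QuotientAddGroup.mk_surjective t

theorem norm_orbitCircle_le (x : X) (t : AddCircle (2 * Real.pi / γ₁)) :
    ‖orbitCircle hper hα x t‖ ≤ ‖x‖ := by
  obtain ⟨s, rfl⟩ := exists_orbitCircle t
  exact hα.norm_map_le s x

theorem fourier_coe_eq (hγ₁ : 0 < γ₁) (n : ℤ) (t : ℝ) :
    fourier n (t : AddCircle (2 * Real.pi / γ₁)) =
      Complex.exp (Complex.I * (((n : ℝ) * γ₁ * t : ℝ) : ℂ)) := by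
  rw [fourier_coe_apply]
  congr 1
  have : (γ₁ : ℂ) ≠ 0 := by exact_mod_cast hγ₁.ne'
  have : (Real.pi : ℂ) ≠ 0 := by exact_mod_cast Real.pi_ne_zero
  push_cast
  field_simp

variable [Fact (0 < 2 * Real.pi / γ₁)]

theorem integrable_of_continuous {E : Type*} [NormedAddCommGroup E]
    {f : AddCircle (2 * Real.pi / γ₁) → E} (hf : Continuous f) :
    Integrable f AddCircle.haarAddCircle :=
  hf.integrable_of_hasCompactSupport (HasCompactSupport.of_compactSpace f)

theorem continuous_fourier_smul (n : ℤ) (x : X) :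
    Continuous fun t => fourier n t • orbitCircle hper hα x t :=
  (fourier n).continuous.smul (continuous_orbitCircle hper hα x)

theorem fourierCoeff_orbitCircle_mem_specZ (hγ₁ : 0 < γ₁) (n : ℤ) (x : X) :
    fourierCoeff (orbitCircle hper hα x) n ∈ specZ α γ₁ n := by
  intro s
  have h1 : α s (fourierCoeff (orbitCircle hper hα x) n) =
      ∫ t, hα.toCLM s (fourier (-n) t • orbitCircle hper hα x t) ∂AddCircle.haarAddCircle :=
    ((hα.toCLM s).integral_comp_comm
      (integrable_of_continuous (continuous_fourier_smul hper hα (-n) x))).symm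
  have h2 := integral_add_left_eq_self (μ := AddCircle.haarAddCircle)
    (fun t => fourier (-n) t • orbitCircle hper hα x t) (s : AddCircle (2 * Real.pi / γ₁))
  rw [h1, fourierCoeff, ← h2, ← integral_smul]
  refine integral_congr_ae (Eventually.of_forall fun t => ?_)
  obtain ⟨r, rfl⟩ := exists_orbitCircle t
  simp only [← AddCircle.coe_add, fourier_coe_eq hγ₁, orbitCircle_coe, hα.map_add_time,
    IsCStarDynSys.toCLM_apply, hα.map_smulc, smul_smul, ← Complex.exp_add]
  congr 2
  push_cast
  ring

theorem fourierCoeff_orbitCircle_mem {S : Set X} (hS : IsClosedSubspace S) (hinv : Invariant α S)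
    {x : X} (hx : x ∈ S) (n : ℤ) : fourierCoeff (orbitCircle hper hα x) n ∈ S := by
  refine hS.convex.integral_mem hS.isClosed (Eventually.of_forall fun t => ?_)
    (integrable_of_continuous (continuous_fourier_smul hper hα (-n) x))
  obtain ⟨s, rfl⟩ := exists_orbitCircle t
  exact hS.smul_mem _ _ (hinv s x hx)

/-- A closed invariant subspace is spanned by its homogeneous elements. -/
theorem subset_of_forall_inter_specZ_subset
    (hper : ∀ x : X, α (2 * Real.pi / γ₁) x = x) (hα : IsCStarDynSys α) (hγ₁ : 0 < γ₁)
    {S T : Set X} (hS : IsClosedSubspace S) (hinv : Invariant α S) (hT : IsClosedSubspace T)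
    (h : ∀ n : ℤ, S ∩ specZ α γ₁ n ⊆ T) :
    S ⊆ T := by
  intro x hx
  refine hT.mem_of_forall_dual fun φ hφ => ?_
  let f : C(AddCircle (2 * Real.pi / γ₁), ℂ) :=
    ⟨fun t => φ (orbitCircle hper hα x t), φ.continuous.comp (continuous_orbitCircle hper hα x)⟩
  have hf : ∀ n, fourierCoeff f n = 0 := by
    intro n
    have h1 : fourierCoeff f n = φ (fourierCoeff (orbitCircle hper hα x) n) := by
      rw [fourierCoeff, fourierCoeff, ← φ.integral_comp_comm
        (integrable_of_continuous (continuous_fourier_smul hper hα (-n) x))]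
      simp [f]
    rw [h1]
    exact hφ _ (h n ⟨fourierCoeff_orbitCircle_mem hper hα hS hinv hx n,
      fourierCoeff_orbitCircle_mem_specZ hper hα hγ₁ n x⟩)
  have hsum : Summable (fourierCoeff f) := by
    simp only [funext hf]
    exact summable_zero
  have h2 := has_pointwise_sum_fourier_series_of_summable hsum ((0 : ℝ) : AddCircle _)
  simp only [hf, zero_smul] at h2
  have h3 := h2.unique hasSum_zero
  have h4 : f ((0 : ℝ) : AddCircle _) = φ x := by
    change φ (α 0 x) = φ x
    rw [hα.map_zero_time]
  rw [← h4, h3]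

/-- The conditional expectation onto the fixed-point algebra. -/
def expectation : X →L[ℂ] X :=
  LinearMap.mkContinuous
    { toFun := fun x => ∫ t, orbitCircle hper hα x t ∂AddCircle.haarAddCircle
      map_add' := fun x y => by
        rw [← integral_add (integrable_of_continuous (continuous_orbitCircle hper hα x))
          (integrable_of_continuous (continuous_orbitCircle hper hα y))]
        refine integral_congr_ae (Eventually.of_forall fun t => ?_)
        obtain ⟨s, rfl⟩ := exists_orbitCircle t
        exact hα.map_add s x y
      map_smul' := fun c x => by
        rw [RingHom.id_apply, ← integral_smul]
        refine integral_congr_ae (Eventually.of_forall fun t => ?_)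
        obtain ⟨s, rfl⟩ := exists_orbitCircle t
        exact hα.map_smulc s c x } 1 fun x => by
    have := norm_integral_le_of_norm_le_const (μ := AddCircle.haarAddCircle)
      (Eventually.of_forall (norm_orbitCircle_le hper hα x))
    simpa using this

theorem expectation_apply (x : X) :
    expectation hper hα x = ∫ t, orbitCircle hper hα x t ∂AddCircle.haarAddCircle := rfl

theorem expectation_eq_fourierCoeff (x : X) :
    expectation hper hα x = fourierCoeff (orbitCircle hper hα x) 0 := by
  simp [expectation_apply, fourierCoeff]

theorem expectation_mem_specZ_zero (hγ₁ : 0 < γ₁) (x : X) :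
    expectation hper hα x ∈ specZ α γ₁ 0 := by
  rw [expectation_eq_fourierCoeff]
  exact fourierCoeff_orbitCircle_mem_specZ hper hα hγ₁ 0 x

theorem expectation_mem {S : Set X} (hS : IsClosedSubspace S) (hinv : Invariant α S)
    {x : X} (hx : x ∈ S) : expectation hper hα x ∈ S := by
  rw [expectation_eq_fourierCoeff]
  exact fourierCoeff_orbitCircle_mem hper hα hS hinv hx 0

theorem expectation_eq_self {x : X} (hx : x ∈ specZ α γ₁ 0) : expectation hper hα x = x := by
  have : ∀ t, orbitCircle hper hα x t = x := by
    intro t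
    obtain ⟨s, rfl⟩ := exists_orbitCircle t
    simpa using hx s
  simp [expectation_apply, this]

theorem expectation_eq_zero (hγ₁ : 0 < γ₁) {n : ℤ} (hn : n ≠ 0) {x : X}
    (hx : x ∈ specZ α γ₁ n) : expectation hper hα x = 0 :=
  specZ_inter_zero hγ₁ hn
    (expectation_mem hper hα (hα.isClosedSubspace_specZ γ₁ n) (hα.invariant_specZ n) hx)
    (expectation_mem_specZ_zero hper hα hγ₁ x)

theorem expectation_mul_right (z : X) {b : X} (hb : b ∈ specZ α γ₁ 0) :
    expectation hper hα (z * b) = expectation hper hα z * b := by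
  have h := ((ContinuousLinearMap.mul ℂ X).flip b).integral_comp_comm
    (integrable_of_continuous (continuous_orbitCircle hper hα z))
  simp only [ContinuousLinearMap.flip_apply, ContinuousLinearMap.mul_apply'] at h
  rw [expectation_apply, expectation_apply, ← h]
  refine integral_congr_ae (Eventually.of_forall fun t => ?_)
  obtain ⟨s, rfl⟩ := exists_orbitCircle t
  have := hb s
  simp only [orbitCircle_coe, hα.map_mul, this]
  simp

theorem expectation_star_mul_mul (z : X) {n : ℤ} {a b : X} (ha : a ∈ specZ α γ₁ n)
    (hb : b ∈ specZ α γ₁ n) :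
    expectation hper hα (star a * z * b) = star a * expectation hper hα z * b := by
  have h := (((ContinuousLinearMap.mul ℂ X).flip b).comp
    (ContinuousLinearMap.mul ℂ X (star a))).integral_comp_comm
    (integrable_of_continuous (continuous_orbitCircle hper hα z))
  simp only [ContinuousLinearMap.comp_apply, ContinuousLinearMap.flip_apply,
    ContinuousLinearMap.mul_apply'] at h
  rw [expectation_apply, expectation_apply, ← h]
  refine integral_congr_ae (Eventually.of_forall fun t => ?_)
  obtain ⟨s, rfl⟩ := exists_orbitCircle t
  simp only [orbitCircle_coe, hα.map_mul, hb s, hα.star_mem_specZ ha s, smul_mul_assoc,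
    mul_smul_comm, smul_smul, ← Complex.exp_add]
  simp

end Circle

end Dynamics

section Ideals

theorem IsClosedTwoSidedIdealIn.isStarSubalgebra {S K : Set X} (hS : ∀ x ∈ S, star x ∈ S)
    (hK : IsClosedTwoSidedIdealIn S K) : IsStarSubalgebra K :=
  ⟨⟨hK.2.2.1, hK.2.2.2.1, hK.2.2.2.2.1, fun x hx y hy => (hK.2.2.2.2.2 x (hK.1 hx) y hy).1⟩,
    fun _ hx => hK.star_mem hS hx⟩

theorem IsClosedTwoSidedIdealIn.mul_mem_left {S K : Set X} (hK : IsClosedTwoSidedIdealIn S K)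
    {s k : X} (hs : s ∈ S) (hk : k ∈ K) : s * k ∈ K := (hK.2.2.2.2.2 s hs k hk).1

theorem IsClosedTwoSidedIdealIn.mul_mem_right {S K : Set X} (hK : IsClosedTwoSidedIdealIn S K)
    {s k : X} (hs : s ∈ S) (hk : k ∈ K) : k * s ∈ K := (hK.2.2.2.2.2 s hs k hk).2

theorem IsClosedTwoSidedIdealIn.mono {S J K : Set X} (hK : IsClosedTwoSidedIdealIn S K)
    (hJS : J ⊆ S) (hKJ : K ⊆ J) : IsClosedTwoSidedIdealIn J K :=
  ⟨hKJ, hK.2.1, hK.2.2.1, hK.2.2.2.1, hK.2.2.2.2.1, fun s hs => hK.2.2.2.2.2 s (hJS hs)⟩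

theorem IsClosedTwoSidedIdealIn.inter {S B K : Set X} (hK : IsClosedTwoSidedIdealIn S K)
    (hBS : B ⊆ S) (hBc : IsClosed B) (hB : IsSubalgebra B) :
    IsClosedTwoSidedIdealIn B (K ∩ B) :=
  ⟨inter_subset_right, hK.2.1.inter hBc, ⟨hK.2.2.1, hB.1⟩,
    fun x hx y hy => ⟨hK.2.2.2.1 x hx.1 y hy.1, hB.2.1 x hx.2 y hy.2⟩,
    fun c x hx => ⟨hK.2.2.2.2.1 c x hx.1, hB.2.2.1 c x hx.2⟩,
    fun s hs k hk => ⟨⟨hK.mul_mem_left (hBS hs) hk.1, hB.2.2.2 s hs k hk.2⟩,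
      ⟨hK.mul_mem_right (hBS hs) hk.1, hB.2.2.2 k hk.2 s hs⟩⟩⟩

theorem isClosedTwoSidedIdealIn_closedSpan {S G : Set X} (hGS : ClosedSpan G ⊆ S)
    (h : ∀ s ∈ S, ∀ g ∈ G, s * g ∈ ClosedSpan G ∧ g * s ∈ ClosedSpan G) :
    IsClosedTwoSidedIdealIn S (ClosedSpan G) := by
  have hc := IsClosedSubspace.closedSpan G
  refine ⟨hGS, hc.isClosed, hc.zero_mem, hc.add_mem, hc.smul_mem, fun s hs k hk => ⟨?_, ?_⟩⟩
  · exact (hc.mul_left s).closedSpan_subset (fun g hg => (h s hs g hg).1) hk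
  · exact (hc.mul_right s).closedSpan_subset (fun g hg => (h s hs g hg).2) hk

/-- A closed ideal of a closed ideal is an ideal of the ambient algebra. -/
theorem IsClosedTwoSidedIdealIn.trans {S J K : Set X} (hS : IsStarSubalgebra S)
    (hJ : IsClosedTwoSidedIdealIn S J) (hK : IsClosedTwoSidedIdealIn J K) :
    IsClosedTwoSidedIdealIn S K := by
  have hJstar : ∀ x ∈ J, star x ∈ J := fun x hx => hJ.star_mem hS.2 hx
  have key : ∀ s ∈ S, ∀ k ∈ K, s * k ∈ K := by
    intro s hs k hk
    refine mem_of_mul_mem hK.2.1 (hK.isStarSubalgebra hJstar) hK.2.1 ?_ fun e he =>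
      hK.mul_mem_left (hJ.mul_mem_left hs (hK.1 hk)) he
    have h1 : star s * (s * k) ∈ J :=
      hJ.mul_mem_left (hS.2 s hs) (hJ.mul_mem_left hs (hK.1 hk))
    simpa [mul_assoc] using hK.mul_mem_right h1 (hK.star_mem hJstar hk)
  refine ⟨hK.1.trans hJ.1, hK.2.1, hK.2.2.1, hK.2.2.2.1, hK.2.2.2.2.1, fun s hs k hk =>
    ⟨key s hs k hk, ?_⟩⟩
  simpa using hK.star_mem hJstar (key _ (hS.2 s hs) _ (hK.star_mem hJstar hk))

theorem IsClosedTwoSidedIdealIn.eq_of_simple {S K : Set X} {x : X}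
    (h : K = {0} ∨ K = S) (hx : x ∈ K) (hx0 : x ≠ 0) : K = S := by
  rcases h with rfl | h
  · exact absurd hx hx0
  · exact h

theorem IsClosedSubspace.closure_add {S T : Set X} (hS : IsClosedSubspace S)
    (hT : IsClosedSubspace T) : IsClosedSubspace (closure (S + T)) := by
  have h : closure (S + T) = ((hS.toSubmodule ⊔ hT.toSubmodule).topologicalClosure : Set X) := by
    rw [Submodule.topologicalClosure_coe, Submodule.coe_sup]
    rfl
  rw [h]
  exact ⟨Submodule.isClosed_topologicalClosure _, Submodule.zero_mem _,
    fun _ hx _ hy => Submodule.add_mem _ hx hy, fun c _ hx => Submodule.smul_mem _ c hx⟩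

end Ideals

section Spectral

variable {α : ℝ → X → X} {γ₁ : ℝ}

/-- The closed linear span of the products `x * star y` with `x`, `y` in the `n`-th spectral
subspace. -/
abbrev spanMulStar (α : ℝ → X → X) (γ₁ : ℝ) (n : ℤ) : Set X :=
  ClosedSpan {z : X | ∃ x ∈ specZ α γ₁ n, ∃ y ∈ specZ α γ₁ n, z = x * star y}

theorem mul_star_mem_spanMulStar {n : ℤ} {x y : X}
    (hx : x ∈ specZ α γ₁ n) (hy : y ∈ specZ α γ₁ n) : x * star y ∈ spanMulStar α γ₁ n :=
  subset_closedSpan _ ⟨x, hx, y, hy, rfl⟩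

namespace IsCStarDynSys

theorem mul_mem_specZ_of_add_eq (hα : IsCStarDynSys α) {m n k : ℤ} (h : m + n = k) {x y : X}
    (hx : x ∈ specZ α γ₁ m) (hy : y ∈ specZ α γ₁ n) : x * y ∈ specZ α γ₁ k :=
  h ▸ hα.mul_mem_specZ hx hy

theorem zero_mul_mem_specZ (hα : IsCStarDynSys α) {n : ℤ} {x y : X}
    (hx : x ∈ specZ α γ₁ 0) (hy : y ∈ specZ α γ₁ n) : x * y ∈ specZ α γ₁ n :=
  hα.mul_mem_specZ_of_add_eq (zero_add n) hx hy

theorem mul_zero_mem_specZ (hα : IsCStarDynSys α) {n : ℤ} {x y : X}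
    (hx : x ∈ specZ α γ₁ n) (hy : y ∈ specZ α γ₁ 0) : x * y ∈ specZ α γ₁ n :=
  hα.mul_mem_specZ_of_add_eq (add_zero n) hx hy

theorem mul_star_mem_specZ_zero (hα : IsCStarDynSys α) {n : ℤ} {x y : X}
    (hx : x ∈ specZ α γ₁ n) (hy : y ∈ specZ α γ₁ n) : x * star y ∈ specZ α γ₁ 0 :=
  hα.mul_mem_specZ_of_add_eq (add_neg_cancel n) hx (hα.star_mem_specZ hy)

theorem star_mul_mem_specZ_zero (hα : IsCStarDynSys α) {n : ℤ} {x y : X}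
    (hx : x ∈ specZ α γ₁ n) (hy : y ∈ specZ α γ₁ n) : star x * y ∈ specZ α γ₁ 0 :=
  hα.mul_mem_specZ_of_add_eq (neg_add_cancel n) (hα.star_mem_specZ hx) hy

theorem star_mul_mem_spanMulStar_neg (hα : IsCStarDynSys α) {n : ℤ} {x y : X}
    (hx : x ∈ specZ α γ₁ n) (hy : y ∈ specZ α γ₁ n) : star x * y ∈ spanMulStar α γ₁ (-n) :=
  subset_closedSpan _ ⟨star x, hα.star_mem_specZ hx, star y, hα.star_mem_specZ hy, by simp⟩

theorem zero_mem_specZ (hα : IsCStarDynSys α) (γ₁ : ℝ) (n : ℤ) : (0 : X) ∈ specZ α γ₁ n :=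
  (hα.isClosedSubspace_specZ γ₁ n).zero_mem

theorem exists_ne_zero_of_specZ_ne (hα : IsCStarDynSys α) {n : ℤ}
    (h : specZ α γ₁ n ≠ ({0} : Set X)) : ∃ x ∈ specZ α γ₁ n, x ≠ 0 :=
  (ne_singleton_zero_iff (hα.zero_mem_specZ γ₁ n)).1 h

theorem specZ_ne_of_mem (hα : IsCStarDynSys α) {n : ℤ} {x : X} (hx : x ∈ specZ α γ₁ n)
    (hx0 : x ≠ 0) : specZ α γ₁ n ≠ ({0} : Set X) :=
  (ne_singleton_zero_iff (hα.zero_mem_specZ γ₁ n)).2 ⟨x, hx, hx0⟩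

theorem specZ_neg_ne (hα : IsCStarDynSys α) {n : ℤ} (h : specZ α γ₁ n ≠ ({0} : Set X)) :
    specZ α γ₁ (-n) ≠ ({0} : Set X) := by
  obtain ⟨x, hx, hx0⟩ := hα.exists_ne_zero_of_specZ_ne h
  exact hα.specZ_ne_of_mem (hα.star_mem_specZ hx) (star_ne_zero.2 hx0)

theorem isClosedTwoSidedIdealIn_spanMulStar (hα : IsCStarDynSys α) (γ₁ : ℝ) (n : ℤ) :
    IsClosedTwoSidedIdealIn (specZ α γ₁ 0) (spanMulStar α γ₁ n) := by
  refine isClosedTwoSidedIdealIn_closedSpan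
    ((hα.isClosedSubspace_specZ γ₁ 0).closedSpan_subset ?_) ?_
  · rintro _ ⟨x, hx, y, hy, rfl⟩
    exact hα.mul_star_mem_specZ_zero hx hy
  · rintro s hs _ ⟨x, hx, y, hy, rfl⟩
    constructor
    · rw [← mul_assoc]
      exact mul_star_mem_spanMulStar (hα.zero_mul_mem_specZ hs hx) hy
    · have h := hα.zero_mul_mem_specZ ((hα.isStarSubalgebra_specZ_zero γ₁).2 s hs) hy
      simpa [mul_assoc] using mul_star_mem_spanMulStar hx h

end IsCStarDynSys

theorem exists_mul_specZ_ne_zero {n : ℤ} {z e : X} (he : e ∈ spanMulStar α γ₁ n)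
    (hze : z * e ≠ 0) : ∃ v ∈ specZ α γ₁ n, z * v ≠ 0 := by
  by_contra! h
  refine hze ((IsClosedSubspace.singleton_zero.mul_left z).closedSpan_subset ?_ he)
  rintro _ ⟨x, hx, y, -, rfl⟩
  simp [← mul_assoc, h x hx]

theorem exists_star_mul_ne_zero {n : ℤ} {x : X} (hx : x ≠ 0)
    (h : x * star x ∈ spanMulStar α γ₁ n) : ∃ a ∈ specZ α γ₁ n, star a * x ≠ 0 := by
  have h1 : star x * (x * star x) ≠ 0 := by
    intro h0
    have h2 : star (x * star x) * (x * star x) = 0 := by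
      rw [star_mul, star_star, mul_assoc, h0, mul_zero]
    exact hx ((CStarRing.mul_star_self_eq_zero_iff x).1
      ((CStarRing.star_mul_self_eq_zero_iff _).1 h2))
  obtain ⟨v, hv, hv0⟩ := exists_mul_specZ_ne_zero h h1
  exact ⟨v, hv, by simpa using star_ne_zero.2 hv0⟩

section Circle

variable [Fact (0 < 2 * Real.pi / γ₁)]

theorem exists_ne_zero_inter_specZ (hper : ∀ x : X, α (2 * Real.pi / γ₁) x = x)
    (hα : IsCStarDynSys α) (hγ₁ : 0 < γ₁) {S : Set X} (hS : IsClosedSubspace S)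
    (hinv : Invariant α S) (h : S ≠ {0}) : ∃ n : ℤ, ∃ x ∈ S ∩ specZ α γ₁ n, x ≠ 0 := by
  obtain ⟨x, hx, hx0⟩ := (ne_singleton_zero_iff hS.zero_mem).1 h
  by_contra! hc
  exact hx0 (subset_of_forall_inter_specZ_subset hper hα hγ₁ hS hinv
    IsClosedSubspace.singleton_zero (fun n y hy => hc n y hy) hx)

theorem expectation_map (hper : ∀ x : X, α (2 * Real.pi / γ₁) x = x)
    (hα : IsCStarDynSys α) (t : ℝ) (x : X) :
    expectation hper hα (α t x) = expectation hper hα x := by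
  rw [expectation_apply, expectation_apply, ← integral_add_right_eq_self
    (orbitCircle hper hα x) (t : AddCircle (2 * Real.pi / γ₁))]
  refine integral_congr_ae (Eventually.of_forall fun r => ?_)
  obtain ⟨s, rfl⟩ := exists_orbitCircle r
  simp only [← AddCircle.coe_add, orbitCircle_coe, hα.map_add_time]

end Circle

end Spectral

section FromConditionS

variable {α : ℝ → X → X} {γ₁ : ℝ} {J : Set X}

/-- The data of Condition (S) for a given ideal `J`. -/
structure IsConditionSIdeal (α : ℝ → X → X) (γ₁ : ℝ) (J : Set X) : Prop where
  ideal : IsClosedTwoSidedIdealIn (specZ α γ₁ 0) J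
  simple : ∀ K : Set X, IsClosedTwoSidedIdealIn J K → K = ({0} : Set X) ∨ K = J
  span_eq : ∀ n : ℤ, 0 < n → specZ α γ₁ n ≠ ({0} : Set X) → spanMulStar α γ₁ n = J

namespace IsConditionSIdeal

theorem star_mem (hα : IsCStarDynSys α) (hJ : IsConditionSIdeal α γ₁ J) :
    ∀ x ∈ J, star x ∈ J :=
  fun _ hx => hJ.ideal.star_mem (hα.isStarSubalgebra_specZ_zero γ₁).2 hx

theorem isStarSubalgebra (hα : IsCStarDynSys α) (hJ : IsConditionSIdeal α γ₁ J) :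
    IsStarSubalgebra J :=
  hJ.ideal.isStarSubalgebra (hα.isStarSubalgebra_specZ_zero γ₁).2

theorem mul_star_mem (hJ : IsConditionSIdeal α γ₁ J) {n : ℤ} (hn : 0 < n) {x y : X}
    (hx : x ∈ specZ α γ₁ n) (hy : y ∈ specZ α γ₁ n) : x * star y ∈ J := by
  by_cases h : specZ α γ₁ n = ({0} : Set X)
  · rw [h] at hx
    rw [mem_singleton_iff.1 hx, zero_mul]
    exact hJ.ideal.2.2.1
  · rw [← hJ.span_eq n hn h]
    exact mul_star_mem_spanMulStar hx hy

theorem spanMulStar_neg_eq_of_lt (hα : IsCStarDynSys α) (hJ : IsConditionSIdeal α γ₁ J) {m n : ℤ}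
    (hm : 0 < m) (hmn : m < n) (hXm : specZ α γ₁ m ≠ ({0} : Set X))
    (hXn : specZ α γ₁ n ≠ ({0} : Set X)) : spanMulStar α γ₁ (-m) = J := by
  have hX0 := (hα.isStarSubalgebra_specZ_zero γ₁).2
  obtain ⟨x, hx, hx0⟩ := hα.exists_ne_zero_of_specZ_ne hXn
  have hxx : x * star x ∈ spanMulStar α γ₁ m := by
    rw [hJ.span_eq m hm hXm]
    exact hJ.mul_star_mem (hm.trans hmn) hx hx
  obtain ⟨a, ha, hax⟩ := exists_star_mul_ne_zero hx0 hxx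
  have hy : star a * x ∈ specZ α γ₁ (n - m) :=
    hα.mul_mem_specZ_of_add_eq (by ring) (hα.star_mem_specZ ha) hx
  have hw := hJ.mul_star_mem (sub_pos.2 hmn) hy hy
  have hw0 : star a * x * star (star a * x) ≠ 0 :=
    (CStarRing.mul_star_self_ne_zero_iff _).2 hax
  have hc : x * star x * a ∈ specZ α γ₁ m :=
    hα.zero_mul_mem_specZ (hα.mul_star_mem_specZ_zero hx hx) ha
  have hwc : star a * x * star (star a * x) = star a * (x * star x * a) := by
    simp [mul_assoc]
  have hM : ClosedSpan {z : X | ∃ u ∈ specZ α γ₁ m, ∃ j ∈ J, ∃ v ∈ specZ α γ₁ m,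
      z = u * j * star v} = J := by
    refine IsClosedTwoSidedIdealIn.eq_of_simple (hJ.simple _ ?_)
      (x := x * star x * a * (star a * x * star (star a * x)) * star (x * star x * a))
      (subset_closedSpan _ ⟨_, hc, _, hw, _, hc, rfl⟩) ?_
    · refine isClosedTwoSidedIdealIn_closedSpan
        (hJ.ideal.isClosedSubspace.closedSpan_subset ?_) ?_
      · rintro _ ⟨u, hu, j, hj, v, hv, rfl⟩
        exact hJ.mul_star_mem hm (hα.mul_zero_mem_specZ hu (hJ.ideal.1 hj)) hv
      · rintro s hs _ ⟨u, hu, j, hj, v, hv, rfl⟩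
        have hs' := hJ.ideal.1 hs
        refine ⟨subset_closedSpan _ ⟨s * u, hα.zero_mul_mem_specZ hs' hu, j, hj, v, hv, ?_⟩,
          subset_closedSpan _ ⟨u, hu, j, hj, star s * v,
            hα.zero_mul_mem_specZ (hX0 s hs') hv, ?_⟩⟩ <;> simp [mul_assoc]
    · intro h
      have h1 : x * star x * a * (star a * x) * star (x * star x * a * (star a * x)) = 0 := by
        rw [← h]
        simp [mul_assoc]
      have h2 := (CStarRing.mul_star_self_eq_zero_iff _).1 h1
      have h3 : star (star (star a * x) * (star a * x)) *
          (star (star a * x) * (star a * x)) = 0 := by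
        have : star (star (star a * x) * (star a * x)) * (star (star a * x) * (star a * x)) =
            star (star a * x) * (star a * (x * star x * a * (star a * x))) := by
          simp [mul_assoc]
        rw [this, h2, mul_zero, mul_zero]
      exact hax ((CStarRing.star_mul_self_eq_zero_iff _).1
        ((CStarRing.star_mul_self_eq_zero_iff _).1 h3))
  have hstar : ∀ v ∈ specZ α γ₁ m, ∀ u ∈ specZ α γ₁ m, star v * u ∈ J := by
    intro v hv u hu
    refine mem_of_mul_mem_left (T := {u | star v * u ∈ J}) hJ.ideal.2.1 (hJ.isStarSubalgebra hα)
      (hJ.ideal.isClosedSubspace.mul_left _).isClosed (hJ.mul_star_mem hm hu hu) fun e he => ?_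
    rw [← hM] at he
    refine (((hJ.ideal.isClosedSubspace.mul_left (star v)).mul_right u)).closedSpan_subset ?_ he
    rintro _ ⟨p, hp, j, hj, q, hq, rfl⟩
    have h := hJ.ideal.mul_mem_right (hα.star_mul_mem_specZ_zero hq hu)
      (hJ.ideal.mul_mem_left (hα.star_mul_mem_specZ_zero hv hp) hj)
    simpa [mul_assoc] using h
  refine IsClosedTwoSidedIdealIn.eq_of_simple (hJ.simple _
    ((hα.isClosedTwoSidedIdealIn_spanMulStar γ₁ (-m)).mono hJ.ideal.1
      (hJ.ideal.isClosedSubspace.closedSpan_subset ?_)))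
    (hα.star_mul_mem_spanMulStar_neg ha hc) (hwc ▸ hw0)
  rintro _ ⟨u, hu, v, hv, rfl⟩
  simpa using hstar _ (hα.star_mem_specZ_neg hu) _ (hα.star_mem_specZ_neg hv)

theorem specZ_add_ne (hα : IsCStarDynSys α) (hJ : IsConditionSIdeal α γ₁ J) {m k : ℤ}
    (hk : 0 < k) (hXk : specZ α γ₁ k ≠ ({0} : Set X)) (hm : spanMulStar α γ₁ (-m) = J) :
    specZ α γ₁ (m + k) ≠ ({0} : Set X) := by
  obtain ⟨x, hx, hx0⟩ := hα.exists_ne_zero_of_specZ_ne hXk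
  obtain ⟨a, ha, hax⟩ := exists_star_mul_ne_zero hx0 (hm ▸ hJ.mul_star_mem hk hx hx)
  exact hα.specZ_ne_of_mem (hα.mul_mem_specZ (hα.star_mem_specZ_neg ha) hx) hax

theorem spanMulStar_eq (hα : IsCStarDynSys α) (hJ : IsConditionSIdeal α γ₁ J) {m n : ℤ}
    (hm : 0 < m) (hmn : m < n) (hXm : specZ α γ₁ m ≠ ({0} : Set X))
    (hXn : specZ α γ₁ n ≠ ({0} : Set X)) {k : ℤ} (hk : k ≠ 0)
    (hXk : specZ α γ₁ k ≠ ({0} : Set X)) : spanMulStar α γ₁ k = J := by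
  rcases hk.lt_or_gt with hk | hk
  · have h := hα.specZ_neg_ne hXk
    have h2 := hJ.specZ_add_ne hα (neg_pos.2 hk) h
      (hJ.spanMulStar_neg_eq_of_lt hα hm hmn hXm hXn)
    simpa using hJ.spanMulStar_neg_eq_of_lt hα (neg_pos.2 hk)
      (lt_add_of_pos_left (-k) hm) h h2
  · exact hJ.span_eq k hk hXk

end IsConditionSIdeal

end FromConditionS

section ExpectationPreimage

variable {α : ℝ → X → X} {γ₁ : ℝ} {J : Set X}

/-- A simple closed ideal of the fixed-point algebra which is spanned by `X_n * star X_n` for all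
nonzero `n` in the spectrum. -/
structure IsSymmetricIdeal (α : ℝ → X → X) (γ₁ : ℝ) (J : Set X) : Prop where
  ideal : IsClosedTwoSidedIdealIn (specZ α γ₁ 0) J
  simple : ∀ K : Set X, IsClosedTwoSidedIdealIn J K → K = ({0} : Set X) ∨ K = J
  span_eq : ∀ n : ℤ, n ≠ 0 → specZ α γ₁ n ≠ ({0} : Set X) → spanMulStar α γ₁ n = J

theorem IsSymmetricIdeal.mul_star_mem (hJ : IsSymmetricIdeal α γ₁ J) {n : ℤ} (hn : n ≠ 0) {x y : X}
    (hx : x ∈ specZ α γ₁ n) (hy : y ∈ specZ α γ₁ n) : x * star y ∈ J := by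
  by_cases h : specZ α γ₁ n = ({0} : Set X)
  · rw [h] at hx
    rw [mem_singleton_iff.1 hx, zero_mul]
    exact hJ.ideal.2.2.1
  · rw [← hJ.span_eq n hn h]
    exact mul_star_mem_spanMulStar hx hy

theorem IsSymmetricIdeal.star_mul_mem (hα : IsCStarDynSys α) (hJ : IsSymmetricIdeal α γ₁ J) {n : ℤ}
    (hn : n ≠ 0) {x y : X} (hx : x ∈ specZ α γ₁ n) (hy : y ∈ specZ α γ₁ n) : star x * y ∈ J := by
  simpa using hJ.mul_star_mem (neg_ne_zero.2 hn) (hα.star_mem_specZ hx) (hα.star_mem_specZ hy)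

/-- The elements whose conditional expectation belongs to `J`. -/
def expectationPreimage (hper : ∀ x : X, α (2 * Real.pi / γ₁) x = x) (hα : IsCStarDynSys α)
    [Fact (0 < 2 * Real.pi / γ₁)] (J : Set X) : Set X :=
  {x | expectation hper hα x ∈ J}

namespace IsSymmetricIdeal

variable [Fact (0 < 2 * Real.pi / γ₁)] (hper : ∀ x : X, α (2 * Real.pi / γ₁) x = x)
  (hα : IsCStarDynSys α)

theorem isClosedSubspace_expectationPreimage (hJ : IsSymmetricIdeal α γ₁ J) :
    IsClosedSubspace (expectationPreimage hper hα J) :=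
  hJ.ideal.isClosedSubspace.preimage (expectation hper hα)

theorem mem_expectationPreimage (hγ₁ : 0 < γ₁) (hJ : IsSymmetricIdeal α γ₁ J) {n : ℤ}
    (hn : n ≠ 0) {x : X} (hx : x ∈ specZ α γ₁ n) : x ∈ expectationPreimage hper hα J := by
  rw [expectationPreimage, mem_ofPred_eq, expectation_eq_zero hper hα hγ₁ hn hx]
  exact hJ.ideal.2.2.1

theorem mem_expectationPreimage_iff {x : X} (hx : x ∈ specZ α γ₁ 0) :
    x ∈ expectationPreimage hper hα J ↔ x ∈ J := by
  rw [expectationPreimage, mem_ofPred_eq, expectation_eq_self hper hα hx]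

theorem expectationPreimage_inter_zero (hJ : IsSymmetricIdeal α γ₁ J) :
    expectationPreimage hper hα J ∩ specZ α γ₁ 0 = J := by
  ext x
  exact ⟨fun h => (mem_expectationPreimage_iff hper hα h.2).1 h.1, fun h =>
    ⟨(mem_expectationPreimage_iff hper hα (hJ.ideal.1 h)).2 h, hJ.ideal.1 h⟩⟩

theorem expectationPreimage_inter (hγ₁ : 0 < γ₁) (hJ : IsSymmetricIdeal α γ₁ J) {n : ℤ}
    (hn : n ≠ 0) : expectationPreimage hper hα J ∩ specZ α γ₁ n = specZ α γ₁ n :=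
  inter_eq_right.2 fun _ hx => hJ.mem_expectationPreimage hper hα hγ₁ hn hx

theorem invariant_expectationPreimage :
    Invariant α (expectationPreimage hper hα J) := by
  intro t x hx
  rwa [expectationPreimage, mem_ofPred_eq, expectation_map]

theorem isClosedTwoSidedIdealIn_expectationPreimage (hγ₁ : 0 < γ₁)
    (hJ : IsSymmetricIdeal α γ₁ J) :
    IsClosedTwoSidedIdealIn univ (expectationPreimage hper hα J) := by
  have hY := hJ.isClosedSubspace_expectationPreimage hper hα
  have hYinv := invariant_expectationPreimage (J := J) hper hα
  have huniv : IsClosedSubspace (univ : Set X) := ⟨isClosed_univ, trivial, by simp, by simp⟩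
  have hunivinv : Invariant α (univ : Set X) := fun _ _ _ => trivial
  have hright : ∀ x ∈ expectationPreimage hper hα J, ∀ s : X,
      x * s ∈ expectationPreimage hper hα J := by
    refine subset_of_forall_inter_specZ_subset hper hα hγ₁ hY hYinv
      (IsClosedSubspace.iInter fun s => hY.mul_right s) fun n x hx s => ?_
    refine subset_of_forall_inter_specZ_subset hper hα hγ₁ huniv hunivinv (hY.mul_left x)
      (fun k s hs => ?_) (mem_univ s)
    have hxs := hα.mul_mem_specZ hx.2 hs.2
    by_cases hnk : n + k = 0
    · obtain rfl : k = -n := by lia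
      have hxs0 := hα.mul_mem_specZ_of_add_eq hnk hx.2 hs.2
      rw [mem_ofPred_eq, mem_expectationPreimage_iff hper hα hxs0]
      by_cases hn : n = 0
      · subst hn
        exact hJ.ideal.mul_mem_right (by simpa using hs.2)
          ((mem_expectationPreimage_iff hper hα hx.2).1 hx.1)
      · simpa using hJ.mul_star_mem hn hx.2 (hα.star_mem_specZ_neg hs.2)
    · exact hJ.mem_expectationPreimage hper hα hγ₁ hnk hxs
  have hleft : ∀ x ∈ expectationPreimage hper hα J, ∀ s : X,
      s * x ∈ expectationPreimage hper hα J := by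
    refine subset_of_forall_inter_specZ_subset hper hα hγ₁ hY hYinv
      (IsClosedSubspace.iInter fun s => hY.mul_left s) fun n x hx s => ?_
    refine subset_of_forall_inter_specZ_subset hper hα hγ₁ huniv hunivinv (hY.mul_right x)
      (fun k s hs => ?_) (mem_univ s)
    have hxs := hα.mul_mem_specZ hs.2 hx.2
    by_cases hnk : k + n = 0
    · obtain rfl : k = -n := by lia
      have hxs0 := hα.mul_mem_specZ_of_add_eq hnk hs.2 hx.2
      rw [mem_ofPred_eq, mem_expectationPreimage_iff hper hα hxs0]
      by_cases hn : n = 0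
      · subst hn
        exact hJ.ideal.mul_mem_left (by simpa using hs.2)
          ((mem_expectationPreimage_iff hper hα hx.2).1 hx.1)
      · simpa using hJ.star_mul_mem hα hn (hα.star_mem_specZ_neg hs.2) hx.2
    · exact hJ.mem_expectationPreimage hper hα hγ₁ hnk hxs
  exact ⟨subset_univ _, hY.isClosed, hY.zero_mem, hY.add_mem, hY.smul_mem, fun s _ k hk =>
    ⟨hleft k hk s, hright k hk s⟩⟩

theorem star_mul_self_mem (hJ : IsSymmetricIdeal α γ₁ J) {n : ℤ} {x : X}
    (hx : x ∈ expectationPreimage hper hα J ∩ specZ α γ₁ n) : star x * x ∈ J := by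
  by_cases hn : n = 0
  · subst hn
    rw [hJ.expectationPreimage_inter_zero] at hx
    exact hJ.ideal.mul_mem_left ((hα.isStarSubalgebra_specZ_zero γ₁).2 _ (hJ.ideal.1 hx)) hx
  · exact hJ.star_mul_mem hα hn hx.2 hx.2

theorem alphaSimple_expectationPreimage (hγ₁ : 0 < γ₁) (hJ : IsSymmetricIdeal α γ₁ J) {K : Set X}
    (hK : IsClosedTwoSidedIdealIn (expectationPreimage hper hα J) K) (hKinv : Invariant α K) :
    K = {0} ∨ K = expectationPreimage hper hα J := by
  have hX0 := hα.isStarSubalgebra_specZ_zero γ₁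
  have hYid := hJ.isClosedTwoSidedIdealIn_expectationPreimage hper hα hγ₁
  have hYstar : ∀ x ∈ expectationPreimage hper hα J, star x ∈ expectationPreimage hper hα J :=
    fun x hx => hYid.star_mem (fun _ _ => mem_univ _) hx
  have hJY : J ⊆ expectationPreimage hper hα J := fun x hx =>
    (mem_expectationPreimage_iff hper hα (hJ.ideal.1 hx)).2 hx
  have hJalg := hJ.ideal.isStarSubalgebra hX0.2
  refine or_iff_not_imp_left.2 fun hK0 => hK.1.antisymm ?_
  obtain ⟨n, x, hx, hx0⟩ :=
    exists_ne_zero_inter_specZ hper hα hγ₁ hK.isClosedSubspace hKinv hK0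
  have hxx := hJ.star_mul_self_mem hper hα ⟨hK.1 hx.1, hx.2⟩
  have hxK : star x * x ∈ K := hK.mul_mem_left (hYstar _ (hK.1 hx.1)) hx.1
  have hKJ : K ∩ J = J := IsClosedTwoSidedIdealIn.eq_of_simple
    (hJ.simple _ (hK.inter hJY hJ.ideal.2.1 hJalg.1)) ⟨hxK, hxx⟩
    ((CStarRing.star_mul_self_ne_zero_iff x).2 hx0)
  have hJK : J ⊆ K := inter_eq_right.1 hKJ
  refine subset_of_forall_inter_specZ_subset hper hα hγ₁ hYid.isClosedSubspace
    (invariant_expectationPreimage hper hα) hK.isClosedSubspace fun k y hy => ?_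
  exact mem_of_mul_mem hJ.ideal.2.1 hJalg hK.2.1 (hJ.star_mul_self_mem hper hα hy)
    fun e he => hK.mul_mem_left hy.1 (hJK he)

theorem exists_mul_ne_zero (hα : IsCStarDynSys α) (hγ₁ : 0 < γ₁) (hJ : IsSymmetricIdeal α γ₁ J)
    {n : ℤ} (hn : expectationPreimage hper hα J ∩ specZ α γ₁ n ≠ {0}) {z : X} (hz : z ∈ J)
    (hz0 : z ≠ 0) : ∃ v ∈ expectationPreimage hper hα J ∩ specZ α γ₁ n, z * v ≠ 0 := by
  have hzs : star z ∈ J := hJ.ideal.star_mem (hα.isStarSubalgebra_specZ_zero γ₁).2 hz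
  have hzz : z * star z ≠ 0 := (CStarRing.mul_star_self_ne_zero_iff z).2 hz0
  by_cases h : n = 0
  · subst h
    rw [hJ.expectationPreimage_inter_zero]
    exact ⟨star z, hzs, hzz⟩
  · rw [hJ.expectationPreimage_inter hper hα hγ₁ h] at hn ⊢
    rw [← hJ.span_eq n h hn] at hzs
    exact exists_mul_specZ_ne_zero hzs hzz

theorem closedSpan_mulSet3_eq (hγ₁ : 0 < γ₁) (hJ : IsSymmetricIdeal α γ₁ J) {n : ℤ}
    (hn : expectationPreimage hper hα J ∩ specZ α γ₁ n ≠ {0}) {Z : Set X}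
    (hZ : IsHereditaryIn (expectationPreimage hper hα J) Z) (hZinv : Invariant α Z)
    (hZ0 : Z ≠ {0}) :
    ClosedSpan (MulSet3 (star '' (Z ∩ specZ α γ₁ n)) Z (Z ∩ specZ α γ₁ n)) = Z := by
  have hX0 := hα.isStarSubalgebra_specZ_zero γ₁
  have hYid := hJ.isClosedTwoSidedIdealIn_expectationPreimage hper hα hγ₁
  have hZsub : IsClosedSubspace Z :=
    ⟨hZ.2.1, hZ.2.2.1.1.1, hZ.2.2.1.1.2.1, hZ.2.2.1.1.2.2.1⟩
  have hZmul := hZ.2.2.1.1.2.2.2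
  have hZstar := hZ.2.2.1.2
  refine (hZsub.closedSpan_subset ?_).antisymm ?_
  · rintro _ ⟨_, ⟨a, ha, rfl⟩, z, hz, b, hb, rfl⟩
    exact hZmul _ (hZmul _ (hZstar _ ha.1) _ hz) _ hb.1
  set D := ClosedSpan (MulSet3 (star '' (Z ∩ specZ α γ₁ n)) Z (Z ∩ specZ α γ₁ n))
  have hDsub : IsClosedSubspace D := IsClosedSubspace.closedSpan _
  set B := Z ∩ specZ α γ₁ 0
  have hBsub : IsClosedSubspace B := hZsub.inter (hα.isClosedSubspace_specZ γ₁ 0)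
  have hBmul : ∀ x ∈ B, ∀ y ∈ B, x * y ∈ B := fun x hx y hy =>
    ⟨hZmul x hx.1 y hy.1, hX0.1.2.2.2 x hx.2 y hy.2⟩
  have hBstar : ∀ x ∈ B, star x ∈ B := fun x hx => ⟨hZstar x hx.1, hX0.2 x hx.2⟩
  have hBalg : IsStarSubalgebra B :=
    ⟨⟨hBsub.zero_mem, hBsub.add_mem, hBsub.smul_mem, hBmul⟩, hBstar⟩
  have hBJ : B ⊆ J := by
    rw [← hJ.expectationPreimage_inter_zero hper hα]
    exact inter_subset_inter_left _ hZ.1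
  obtain ⟨b, hb, hb0⟩ : ∃ b ∈ B, b ≠ 0 := by
    obtain ⟨k, z, hz, hz0⟩ := exists_ne_zero_inter_specZ hper hα hγ₁ hZsub hZinv hZ0
    exact ⟨star z * z, ⟨hZmul _ (hZstar z hz.1) _ hz.1, hα.star_mul_mem_specZ_zero hz.2 hz.2⟩,
      (CStarRing.star_mul_self_ne_zero_iff z).2 hz0⟩
  obtain ⟨v, hv, hbv⟩ := hJ.exists_mul_ne_zero hper hα hγ₁ hn (hBJ hb) hb0
  have hW : ClosedSpan {w : X | ∃ u ∈ expectationPreimage hper hα J ∩ specZ α γ₁ n, ∃ p ∈ B,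
      ∃ q ∈ B, ∃ v ∈ expectationPreimage hper hα J ∩ specZ α γ₁ n,
        w = star u * (p * q) * v} = J := by
    refine IsClosedTwoSidedIdealIn.eq_of_simple (hJ.simple _ ?_)
      (x := star v * (star b * b) * v)
      (subset_closedSpan _ ⟨v, hv, star b, hBstar b hb, b, hb, v, hv, rfl⟩) ?_
    · refine isClosedTwoSidedIdealIn_closedSpan
        (hJ.ideal.isClosedSubspace.closedSpan_subset ?_) ?_
      · rintro _ ⟨u, hu, p, hp, q, hq, v, hv, rfl⟩
        rw [← hJ.expectationPreimage_inter_zero hper hα]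
        refine ⟨hYid.mul_mem_left trivial hv.1, ?_⟩
        rw [mul_assoc]
        exact hα.star_mul_mem_specZ_zero hu.2
          (hα.zero_mul_mem_specZ (hBmul p hp q hq).2 hv.2)
      · rintro s hs _ ⟨u, hu, p, hp, q, hq, v, hv, rfl⟩
        have hs' := hJ.ideal.1 hs
        refine ⟨subset_closedSpan _ ⟨u * star s, ⟨hYid.mul_mem_right trivial hu.1,
          hα.mul_zero_mem_specZ hu.2 (hX0.2 s hs')⟩, p, hp, q, hq, v, hv, ?_⟩,
          subset_closedSpan _ ⟨u, hu, p, hp, q, hq, v * s, ⟨hYid.mul_mem_right trivial hv.1,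
            hα.mul_zero_mem_specZ hv.2 hs'⟩, ?_⟩⟩ <;> simp [mul_assoc]
    · have : star v * (star b * b) * v = star (b * v) * (b * v) := by simp [mul_assoc]
      rw [this]
      exact (CStarRing.star_mul_self_ne_zero_iff _).2 hbv
  have hsandwich : ∀ p ∈ B, ∀ j ∈ J, ∀ q ∈ B, ∀ q' ∈ B, ∀ j' ∈ J, ∀ p' ∈ B, ∀ z ∈ Z,
      p * j * q * z * (q' * j' * p') ∈ D := by
    intro p hp j hj q hq q' hq' j' hj' p' hp' z hz
    rw [← hW] at hj hj'
    have h1 := ((((hDsub.mul_right (q' * j' * p')).mul_right z).mul_right q).mul_left p)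
    refine h1.closedSpan_subset ?_ hj
    rintro _ ⟨u, hu, r, hr, s, hs, v, hv, rfl⟩
    have h2 := ((hDsub.mul_left (p * (star u * (r * s) * v) * q * z)).mul_right p').mul_left q'
    refine h2.closedSpan_subset ?_ hj'
    rintro _ ⟨u', hu', r', hr', s', hs', v', hv', rfl⟩
    have ha : star r * u * star p ∈ Z ∩ specZ α γ₁ n :=
      ⟨hZ.mul_mul_mem hYid (hBstar r hr).1 (hBstar p hp).1 u,
        hα.mul_zero_mem_specZ (hα.zero_mul_mem_specZ (hBstar r hr).2 hu.2) (hBstar p hp).2⟩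
    have hb' : s' * v' * p' ∈ Z ∩ specZ α γ₁ n :=
      ⟨hZ.mul_mul_mem hYid hs'.1 hp'.1 v',
        hα.mul_zero_mem_specZ (hα.zero_mul_mem_specZ hs'.2 hv'.2) hp'.2⟩
    have hmid : s * v * q * z * (q' * star u' * r') ∈ Z :=
      hZmul _ (hZmul _ (hZ.mul_mul_mem hYid hs.1 hq.1 v) _ hz) _
        (hZ.mul_mul_mem hYid hq'.1 hr'.1 _)
    have h3 : star (star r * u * star p) * (s * v * q * z * (q' * star u' * r')) *
        (s' * v' * p') ∈ D := subset_closedSpan _ ⟨_, ⟨_, ha, rfl⟩, _, hmid, _, hb', rfl⟩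
    simpa [mul_assoc] using h3
  refine subset_of_forall_inter_specZ_subset hper hα hγ₁ hZsub hZinv hDsub fun k z hz => ?_
  refine mem_of_mul_mul_mem hBsub.isClosed hBalg hDsub.isClosed
    ⟨hZmul _ (hZstar z hz.1) _ hz.1, hα.star_mul_mem_specZ_zero hz.2 hz.2⟩
    ⟨hZmul _ hz.1 _ (hZstar z hz.1), hα.mul_star_mem_specZ_zero hz.2 hz.2⟩ fun d hd e he => ?_
  refine mem_of_mul_mul_mem (T := {d | d * z * e ∈ D}) hBsub.isClosed hBalg
    ((hDsub.mul_right e).mul_right z).isClosed (hBmul _ (hBstar d hd) _ hd)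
    (hBmul _ hd _ (hBstar d hd)) fun p hp q hq => ?_
  refine mem_of_mul_mul_mem (T := {e | p * d * q * z * e ∈ D}) hBsub.isClosed hBalg
    (hDsub.mul_left _).isClosed (hBmul _ (hBstar e he) _ he)
    (hBmul _ he _ (hBstar e he)) fun q' hq' p' hp' => ?_
  exact hsandwich p hp d (hBJ hd) q hq q' hq' e (hBJ he) p' hp' z hz.1

theorem condition43Periodic (hper : ∀ x : X, α (2 * Real.pi / γ₁) x = x)
    (hα : IsCStarDynSys α) (hγ₁ : 0 < γ₁) (hJ : IsSymmetricIdeal α γ₁ J) (hJ0 : J ≠ {0}) :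
    Condition43Periodic α γ₁ := by
  have hYid := hJ.isClosedTwoSidedIdealIn_expectationPreimage hper hα hγ₁
  have hYsub := hYid.isClosedSubspace
  have hYinv := invariant_expectationPreimage (J := J) hper hα
  refine Or.inr ⟨expectationPreimage hper hα J, hYid, hYinv,
    fun K hK hKinv => hJ.alphaSimple_expectationPreimage hper hα hγ₁ hK hKinv, ?_, ?_, ?_⟩
  · congr 1
    refine iUnion₂_congr fun n hn => hJ.expectationPreimage_inter hper hα hγ₁ ?_
    have : (1 : ℤ) ≤ n := hn
    lia
  · ext n
    refine ⟨fun hn Z hZ hZinv hZ0 => hJ.closedSpan_mulSet3_eq hper hα hγ₁ hn hZ hZinv hZ0,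
      fun h hn => ?_⟩
    have hY0 : expectationPreimage hper hα J ≠ {0} := by
      obtain ⟨x, hx, hx0⟩ := (ne_singleton_zero_iff hJ.ideal.2.2.1).1 hJ0
      exact (ne_singleton_zero_iff hYsub.zero_mem).2
        ⟨x, (mem_expectationPreimage_iff hper hα (hJ.ideal.1 hx)).2 hx, hx0⟩
    have h1 := h _ ⟨Subset.rfl, hYsub.isClosed, hYid.isStarSubalgebra fun _ _ => mem_univ _,
      fun x hx _ _ _ _ => hx⟩ hYinv hY0
    refine hY0 (Subset.antisymm ?_ (singleton_subset_iff.2 hYsub.zero_mem))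
    rw [← h1, hn]
    refine IsClosedSubspace.singleton_zero.closedSpan_subset ?_
    rintro _ ⟨a, -, z, -, b, rfl, rfl⟩
    simp
  · have hC := IsClosedSubspace.closedSpan (⋃ n ∈ Ici (0 : ℤ), specZ α γ₁ n)
    refine (subset_univ _).antisymm ?_
    refine subset_of_forall_inter_specZ_subset hper hα hγ₁
      ⟨isClosed_univ, trivial, by simp, by simp⟩ (fun _ _ _ => trivial)
      (hYsub.closure_add hC) fun n x hx => subset_closure ?_
    by_cases hn : n = 0
    · exact ⟨0, hYsub.zero_mem, x, subset_closedSpan _ (mem_biUnion hn.ge hx.2), zero_add x⟩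
    · exact ⟨x, hJ.mem_expectationPreimage hper hα hγ₁ hn hx.2, 0, hC.zero_mem, add_zero x⟩

end IsSymmetricIdeal

end ExpectationPreimage

section FromSimpleIdeal

variable {α : ℝ → X → X} {γ₁ : ℝ} {Y K : Set X}

/-- The closed linear span of `star u * k * v` with `u`, `v` in the `n`-th spectral subspace
of `Y` and `k` in `K`. -/
def compress (α : ℝ → X → X) (γ₁ : ℝ) (Y K : Set X) (n : ℤ) : Set X :=
  ClosedSpan {z : X | ∃ u ∈ Y ∩ specZ α γ₁ n, ∃ k ∈ K, ∃ v ∈ Y ∩ specZ α γ₁ n,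
    z = star u * k * v}

/-- An invariant closed ideal all of whose spectrum lies in its strong Connes spectrum. -/
structure IsFullConnesIdeal (α : ℝ → X → X) (γ₁ : ℝ) (Y : Set X) : Prop where
  ideal : IsClosedTwoSidedIdealIn univ Y
  invariant : Invariant α Y
  closedSpan_eq : ∀ n : ℤ, Y ∩ specZ α γ₁ n ≠ {0} → ∀ Z : Set X, IsHereditaryIn Y Z →
    Invariant α Z → Z ≠ {0} →
      ClosedSpan (MulSet3 (star '' (Z ∩ specZ α γ₁ n)) Z (Z ∩ specZ α γ₁ n)) = Z

namespace IsFullConnesIdeal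

theorem star_mem (hY : IsFullConnesIdeal α γ₁ Y) : ∀ x ∈ Y, star x ∈ Y :=
  fun _ hx => hY.ideal.star_mem (fun _ _ => mem_univ _) hx

theorem inter_neg_ne (hα : IsCStarDynSys α) (hY : IsFullConnesIdeal α γ₁ Y) {n : ℤ}
    (h : Y ∩ specZ α γ₁ n ≠ {0}) : Y ∩ specZ α γ₁ (-n) ≠ {0} := by
  have hsub : ∀ n, IsClosedSubspace (Y ∩ specZ α γ₁ n) := fun n =>
    hY.ideal.isClosedSubspace.inter (hα.isClosedSubspace_specZ γ₁ n)
  obtain ⟨x, hx, hx0⟩ := (ne_singleton_zero_iff (hsub n).zero_mem).1 h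
  exact (ne_singleton_zero_iff (hsub (-n)).zero_mem).2
    ⟨star x, ⟨hY.star_mem x hx.1, hα.star_mem_specZ hx.2⟩, star_ne_zero.2 hx0⟩

theorem inter_zero_isIdeal (hα : IsCStarDynSys α) (hY : IsFullConnesIdeal α γ₁ Y) :
    IsClosedTwoSidedIdealIn (specZ α γ₁ 0) (Y ∩ specZ α γ₁ 0) :=
  hY.ideal.inter (subset_univ _) (hα.isClosedSubspace_specZ γ₁ 0).isClosed
    (hα.isStarSubalgebra_specZ_zero γ₁).1

theorem compress_subset (hα : IsCStarDynSys α) (hY : IsFullConnesIdeal α γ₁ Y)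
    (hK : IsClosedTwoSidedIdealIn (specZ α γ₁ 0) K) (n : ℤ) :
    compress α γ₁ Y K n ⊆ Y ∩ specZ α γ₁ 0 := by
  refine (hY.ideal.isClosedSubspace.inter
    (hα.isClosedSubspace_specZ γ₁ 0)).closedSpan_subset ?_
  rintro _ ⟨u, hu, k, hk, v, hv, rfl⟩
  refine ⟨hY.ideal.mul_mem_left trivial hv.1, ?_⟩
  rw [mul_assoc]
  exact hα.star_mul_mem_specZ_zero hu.2 (hα.zero_mul_mem_specZ (hK.1 hk) hv.2)

theorem compress_isIdeal (hα : IsCStarDynSys α) (hY : IsFullConnesIdeal α γ₁ Y)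
    (hK : IsClosedTwoSidedIdealIn (specZ α γ₁ 0) K) (n : ℤ) :
    IsClosedTwoSidedIdealIn (specZ α γ₁ 0) (compress α γ₁ Y K n) := by
  refine isClosedTwoSidedIdealIn_closedSpan
    ((hY.compress_subset hα hK n).trans inter_subset_right) ?_
  rintro s hs _ ⟨u, hu, k, hk, v, hv, rfl⟩
  have hs' := (hα.isStarSubalgebra_specZ_zero γ₁).2 s hs
  refine ⟨subset_closedSpan _ ⟨u * star s, ⟨hY.ideal.mul_mem_right trivial hu.1,
    hα.mul_zero_mem_specZ hu.2 hs'⟩, k, hk, v, hv, ?_⟩,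
    subset_closedSpan _ ⟨u, hu, k, hk, v * s, ⟨hY.ideal.mul_mem_right trivial hv.1,
      hα.mul_zero_mem_specZ hv.2 hs⟩, ?_⟩⟩ <;> simp [mul_assoc]

variable [Fact (0 < 2 * Real.pi / γ₁)]

theorem subset_compress (hper : ∀ x : X, α (2 * Real.pi / γ₁) x = x) (hα : IsCStarDynSys α)
    (hγ₁ : 0 < γ₁) (hY : IsFullConnesIdeal α γ₁ Y)
    (hK : IsClosedTwoSidedIdealIn (specZ α γ₁ 0) K) (hKY : K ⊆ Y) {n : ℤ}
    (hn : Y ∩ specZ α γ₁ n ≠ {0}) : K ⊆ compress α γ₁ Y K n := by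
  have hX0 := hα.isStarSubalgebra_specZ_zero γ₁
  have hKstar : ∀ x ∈ K, star x ∈ K := fun x hx => hK.star_mem hX0.2 hx
  have hMsub : IsClosedSubspace (compress α γ₁ Y K n) := IsClosedSubspace.closedSpan _
  intro k hk
  by_cases hk0 : k = 0
  · rw [hk0]
    exact hMsub.zero_mem
  set L : Set X := ClosedSpan {z : X | ∃ y : X, ∃ k ∈ K, z = y * k}
  have hLsub : IsClosedSubspace L := IsClosedSubspace.closedSpan _
  have hLY : L ⊆ Y := by
    refine hY.ideal.isClosedSubspace.closedSpan_subset ?_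
    rintro _ ⟨y, k, hk, rfl⟩
    exact hY.ideal.mul_mem_left trivial (hKY hk)
  have hKL : K ⊆ L := fun x hx => mem_of_mul_mem hK.2.1 (hK.isStarSubalgebra hX0.2)
    hLsub.isClosed (hK.mul_mem_left (hX0.2 x (hK.1 hx)) hx)
    fun e he => subset_closedSpan _ ⟨x, e, he, rfl⟩
  have hLmul : ∀ y : X, ∀ x ∈ L, y * x ∈ L := by
    intro y
    refine (hLsub.mul_left y).closedSpan_subset ?_
    rintro _ ⟨z, k, hk, rfl⟩
    exact subset_closedSpan _ ⟨y * z, k, hk, (mul_assoc _ _ _).symm⟩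
  have hLinv : Invariant α L := by
    refine hα.invariant_closedSpan ?_
    rintro t _ ⟨y, k, hk, rfl⟩
    have h0 : α t k = k := by simpa using hK.1 hk t
    exact ⟨α t y, k, hk, by rw [hα.map_mul, h0]⟩
  have hLE : ∀ x ∈ L, expectation hper hα x ∈ K := by
    refine (hK.isClosedSubspace.preimage (expectation hper hα)).closedSpan_subset ?_
    rintro _ ⟨y, k, hk, rfl⟩
    rw [mem_ofPred_eq, expectation_mul_right hper hα y (hK.1 hk)]
    exact hK.mul_mem_left (expectation_mem_specZ_zero hper hα hγ₁ y) hk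
  have hZher := isHereditaryIn_inter_star hLY hLsub.isClosed hLsub.zero_mem hLsub.add_mem
    hLsub.smul_mem hLmul
  set Z : Set X := {x | x ∈ L ∧ star x ∈ L}
  have hKZ : K ⊆ Z := fun x hx => ⟨hKL hx, hKL (hKstar x hx)⟩
  have hZinv : Invariant α Z := fun t x hx =>
    ⟨hLinv t x hx.1, by rw [← hα.map_star]; exact hLinv t _ hx.2⟩
  have hZ0 : Z ≠ {0} := (ne_singleton_zero_iff hZher.2.2.1.1.1).2 ⟨k, hKZ hk, hk0⟩
  have hkZ := hKZ hk
  rw [← hY.closedSpan_eq n hn Z hZher hZinv hZ0] at hkZ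
  rw [← expectation_eq_self hper hα (hK.1 hk)]
  refine (hMsub.preimage (expectation hper hα)).closedSpan_subset ?_ hkZ
  rintro _ ⟨_, ⟨a, ha, rfl⟩, z, hz, b, hb, rfl⟩
  rw [mem_ofPred_eq, expectation_star_mul_mul hper hα z ha.2 hb.2]
  exact subset_closedSpan _ ⟨a, ⟨hLY ha.1.1, ha.2⟩, _, hLE z hz.1, b, ⟨hLY hb.1.1, hb.2⟩, rfl⟩

theorem star_mul_mul_mem (hper : ∀ x : X, α (2 * Real.pi / γ₁) x = x) (hα : IsCStarDynSys α)
    (hγ₁ : 0 < γ₁) (hY : IsFullConnesIdeal α γ₁ Y)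
    (hK : IsClosedTwoSidedIdealIn (specZ α γ₁ 0) K) {n : ℤ} {u k v : X}
    (hu : u ∈ Y ∩ specZ α γ₁ n) (hk : k ∈ K) (hv : v ∈ Y ∩ specZ α γ₁ n) :
    star u * k * v ∈ K := by
  by_cases hn : Y ∩ specZ α γ₁ n = {0}
  · rw [hn] at hu
    rw [mem_singleton_iff.1 hu]
    simpa using hK.2.2.1
  have hM := hY.compress_isIdeal hα hK n
  have h := hY.subset_compress hper hα hγ₁ hM
    ((hY.compress_subset hα hK n).trans inter_subset_left) (hY.inter_neg_ne hα hn)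
    (subset_closedSpan _ ⟨u, hu, k, hk, v, hv, rfl⟩)
  refine hK.isClosedSubspace.closedSpan_subset ?_ h
  rintro _ ⟨a, ha, m, hm, b, hb, rfl⟩
  refine ((hK.isClosedSubspace.mul_right b).mul_left (star a)).closedSpan_subset ?_ hm
  rintro _ ⟨p, hp, k, hk, q, hq, rfl⟩
  have h1 : star a * star p ∈ specZ α γ₁ 0 :=
    hα.mul_mem_specZ_of_add_eq (add_neg_cancel n) (hα.star_mem_specZ_neg ha.2)
      (hα.star_mem_specZ hp.2)
  have h2 : q * b ∈ specZ α γ₁ 0 :=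
    hα.mul_mem_specZ_of_add_eq (add_neg_cancel n) hq.2 hb.2
  simpa [mul_assoc] using hK.mul_mem_right h2 (hK.mul_mem_left h1 hk)

theorem simple_inter_zero (hper : ∀ x : X, α (2 * Real.pi / γ₁) x = x) (hα : IsCStarDynSys α)
    (hγ₁ : 0 < γ₁) (hY : IsFullConnesIdeal α γ₁ Y)
    (hsimple : ∀ K : Set X, IsClosedTwoSidedIdealIn Y K → Invariant α K → K = {0} ∨ K = Y)
    (hK : IsClosedTwoSidedIdealIn (Y ∩ specZ α γ₁ 0) K) : K = {0} ∨ K = Y ∩ specZ α γ₁ 0 := by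
  have hX0 := hα.isStarSubalgebra_specZ_zero γ₁
  have hKY : K ⊆ Y := hK.1.trans inter_subset_left
  have hKX := IsClosedTwoSidedIdealIn.trans hX0 (hY.inter_zero_isIdeal hα) hK
  have hKalg := hKX.isStarSubalgebra hX0.2
  refine or_iff_not_imp_left.2 fun hK0 => hK.1.antisymm ?_
  obtain ⟨k, hk, hk0⟩ := (ne_singleton_zero_iff hK.2.2.1).1 hK0
  set N : Set X := ClosedSpan {z : X | ∃ x ∈ Y, ∃ k ∈ K, ∃ y ∈ Y, z = x * k * y}
  have hNY : N ⊆ Y := by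
    refine hY.ideal.isClosedSubspace.closedSpan_subset ?_
    rintro _ ⟨x, hx, k, hk, y, hy, rfl⟩
    exact hY.ideal.mul_mem_left trivial hy
  have hNid : IsClosedTwoSidedIdealIn Y N := by
    refine isClosedTwoSidedIdealIn_closedSpan hNY ?_
    rintro s hs _ ⟨x, hx, k, hk, y, hy, rfl⟩
    exact ⟨subset_closedSpan _ ⟨s * x, hY.ideal.mul_mem_left trivial hx, k, hk, y, hy,
      by simp [mul_assoc]⟩, subset_closedSpan _ ⟨x, hx, k, hk, y * s,
      hY.ideal.mul_mem_right trivial hy, by simp [mul_assoc]⟩⟩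
  have hNinv : Invariant α N := by
    refine hα.invariant_closedSpan ?_
    rintro t _ ⟨x, hx, k, hk, y, hy, rfl⟩
    have h0 : α t k = k := by simpa using hKX.1 hk t
    exact ⟨α t x, hY.invariant t x hx, k, hk, α t y, hY.invariant t y hy,
      by rw [hα.map_mul, hα.map_mul, h0]⟩
  have hkN : k ∈ N := mem_of_mul_mul_mem hK.2.1 hKalg hNid.2.1
    (hKX.mul_mem_left (hX0.2 k (hKX.1 hk)) hk) (hKX.mul_mem_right (hX0.2 k (hKX.1 hk)) hk)
    fun d hd e he => subset_closedSpan _ ⟨d, hKY hd, k, hk, e, hKY he, rfl⟩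
  have hNeq : N = Y := IsClosedTwoSidedIdealIn.eq_of_simple (hsimple N hNid hNinv) hkN hk0
  have hE := hK.isClosedSubspace.preimage (expectation hper hα)
  have hNE : ∀ z ∈ N, expectation hper hα z ∈ K := by
    refine hE.closedSpan_subset ?_
    rintro _ ⟨x, hx, k, hk, y, hy, rfl⟩
    refine subset_of_forall_inter_specZ_subset hper hα hγ₁ hY.ideal.isClosedSubspace hY.invariant
      ((hE.mul_right y).mul_right k) (fun a x hx => ?_) hx
    refine subset_of_forall_inter_specZ_subset hper hα hγ₁ hY.ideal.isClosedSubspace hY.invariant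
      (hE.mul_left (x * k)) (fun b y hy => ?_) hy
    rw [mem_ofPred_eq, mem_ofPred_eq]
    have hxk := hα.mul_zero_mem_specZ hx.2 (hKX.1 hk)
    by_cases hab : a + b = 0
    · obtain rfl : b = -a := by lia
      rw [expectation_eq_self hper hα (hα.mul_mem_specZ_of_add_eq hab hxk hy.2)]
      simpa using hY.star_mul_mul_mem hper hα hγ₁ hKX
        ⟨hY.star_mem x hx.1, hα.star_mem_specZ hx.2⟩ hk hy
    · rw [expectation_eq_zero hper hα hγ₁ hab (hα.mul_mem_specZ hxk hy.2)]
      exact hK.2.2.1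
  intro j hj
  rw [← expectation_eq_self hper hα hj.2]
  exact hNE j (hNeq ▸ hj.1)

theorem spanMulStar_eq (hper : ∀ x : X, α (2 * Real.pi / γ₁) x = x) (hα : IsCStarDynSys α)
    (hγ₁ : 0 < γ₁) (hY : IsFullConnesIdeal α γ₁ Y) {n : ℤ} (hn : specZ α γ₁ n ≠ ({0} : Set X))
    (hXY : specZ α γ₁ n ⊆ Y) : spanMulStar α γ₁ n = Y ∩ specZ α γ₁ 0 := by
  have hsub : IsClosedSubspace (spanMulStar α γ₁ n) := IsClosedSubspace.closedSpan _
  refine Subset.antisymm ((hY.ideal.isClosedSubspace.inter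
    (hα.isClosedSubspace_specZ γ₁ 0)).closedSpan_subset ?_) fun k hk => ?_
  · rintro _ ⟨x, hx, y, hy, rfl⟩
    exact ⟨hY.ideal.mul_mem_right trivial (hXY hx), hα.mul_star_mem_specZ_zero hx hy⟩
  · obtain ⟨x, hx, hx0⟩ := hα.exists_ne_zero_of_specZ_ne hn
    have h := hY.closedSpan_eq (-n) (hY.inter_neg_ne hα (by rwa [inter_eq_right.2 hXY])) Y
      ⟨Subset.rfl, hY.ideal.2.1, hY.ideal.isStarSubalgebra fun _ _ => mem_univ _,
        fun x hx _ _ _ _ => hx⟩ hY.invariant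
      ((ne_singleton_zero_iff hY.ideal.2.2.1).2 ⟨x, hXY hx, hx0⟩)
    have hkY := hk.1
    rw [← h] at hkY
    rw [← expectation_eq_self hper hα hk.2]
    refine (hsub.preimage (expectation hper hα)).closedSpan_subset ?_ hkY
    rintro _ ⟨_, ⟨a, ha, rfl⟩, z, -, b, hb, rfl⟩
    rw [mem_ofPred_eq, expectation_star_mul_mul hper hα z ha.2 hb.2, mul_assoc]
    have h1 := hα.star_mem_specZ_neg (hα.zero_mul_mem_specZ
      (expectation_mem_specZ_zero hper hα hγ₁ z) hb.2)
    simpa using mul_star_mem_spanMulStar (hα.star_mem_specZ_neg ha.2) h1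

end IsFullConnesIdeal

end FromSimpleIdeal

section MainImplications

variable {α : ℝ → X → X} {γ₁ : ℝ}

theorem exists_pos_specZ_ne (hα : IsCStarDynSys α)
    (h : ∃ n : ℤ, n ≠ 0 ∧ specZ α γ₁ n ≠ ({0} : Set X)) :
    ∃ n : ℤ, 0 < n ∧ specZ α γ₁ n ≠ ({0} : Set X) := by
  obtain ⟨n, hn, hX⟩ := h
  rcases hn.lt_or_gt with hn | hn
  · exact ⟨-n, neg_pos.2 hn, hα.specZ_neg_ne hX⟩
  · exact ⟨n, hn, hX⟩

theorem conditionS_of_condition43Periodic [Fact (0 < 2 * Real.pi / γ₁)] (hα : IsCStarDynSys α)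
    (hγ₁ : 0 < γ₁) (hper : ∀ x : X, α (2 * Real.pi / γ₁) x = x)
    (h : Condition43Periodic α γ₁) : ConditionS α γ₁ := by
  rcases h with ⟨m, hm, hsp, hid, hsimple⟩ | ⟨Y, hYid, hYinv, hYsimple, hb1, hb2, -⟩
  · refine ⟨_, hid, hsimple, fun n hn hX => ?_⟩
    have h1 : n ∈ ({-m, 0, m} : Set ℤ) := hsp ▸ hX
    obtain rfl : n = m := by
      rcases h1 with rfl | rfl | rfl
      · lia
      · lia
      · rfl
    rfl
  · have hY : IsFullConnesIdeal α γ₁ Y := ⟨hYid, hYinv, fun n hn => hb2.subset hn⟩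
    refine ⟨Y ∩ specZ α γ₁ 0, hY.inter_zero_isIdeal hα,
      fun K hK => hY.simple_inter_zero hper hα hγ₁ hYsimple hK, fun n hn hX => ?_⟩
    refine hY.spanMulStar_eq hper hα hγ₁ hX fun x hx => ?_
    refine hYid.isClosedSubspace.closedSpan_subset (iUnion₂_subset fun _ _ => inter_subset_left)
      (hb1.superset (subset_closedSpan _ ?_))
    exact mem_biUnion (show n ∈ Ici (1 : ℤ) from hn) hx

theorem condition43Periodic_of_conditionS [Fact (0 < 2 * Real.pi / γ₁)] (hα : IsCStarDynSys α)
    (hγ₁ : 0 < γ₁) (hper : ∀ x : X, α (2 * Real.pi / γ₁) x = x)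
    (hnontrivial : ∃ n : ℤ, n ≠ 0 ∧ specZ α γ₁ n ≠ ({0} : Set X))
    (h : ConditionS α γ₁) : Condition43Periodic α γ₁ := by
  obtain ⟨J, hid, hsimple, hspan⟩ := h
  have hJ : IsConditionSIdeal α γ₁ J := ⟨hid, hsimple, hspan⟩
  obtain ⟨m, hm, hXm⟩ := exists_pos_specZ_ne hα hnontrivial
  obtain ⟨x, hx, hx0⟩ := hα.exists_ne_zero_of_specZ_ne hXm
  have hxx : x * star x ≠ 0 := (CStarRing.mul_star_self_ne_zero_iff x).2 hx0
  by_cases htwo : ∃ k l : ℤ, 0 < k ∧ k < l ∧ specZ α γ₁ k ≠ ({0} : Set X) ∧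
      specZ α γ₁ l ≠ ({0} : Set X)
  · obtain ⟨k, l, hk, hkl, hXk, hXl⟩ := htwo
    exact IsSymmetricIdeal.condition43Periodic hper hα hγ₁
      ⟨hid, hsimple, fun n hn hXn => hJ.spanMulStar_eq hα hk hkl hXk hXl hn hXn⟩
      ((ne_singleton_zero_iff hid.2.2.1).2 ⟨_, hJ.mul_star_mem hm hx hx, hxx⟩)
  · have huniq : ∀ n : ℤ, 0 < n → specZ α γ₁ n ≠ ({0} : Set X) → n = m := by
      intro n hn hXn
      by_contra hne
      rcases lt_or_gt_of_ne hne with hlt | hlt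
      · exact htwo ⟨n, m, hn, hlt, hXn, hXm⟩
      · exact htwo ⟨m, n, hm, hlt, hXm, hXn⟩
    have hJm : spanMulStar α γ₁ m = J := hspan m hm hXm
    subst hJm
    refine Or.inl ⟨m, hm, ?_, hid, hsimple⟩
    ext n
    constructor
    · intro hXn
      rcases lt_trichotomy n 0 with hn | hn | hn
      · exact Or.inl (by linarith [huniq (-n) (neg_pos.2 hn) (hα.specZ_neg_ne hXn)])
      · exact Or.inr (Or.inl hn)
      · exact Or.inr (Or.inr (huniq n hn hXn))
    · rintro (rfl | rfl | rfl)
      · exact hα.specZ_neg_ne hXm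
      · exact hα.specZ_ne_of_mem (hα.mul_star_mem_specZ_zero hx hx) hxx
      · exact hXm

end MainImplications

/-- **Proposition 4.5.** For a nontrivial periodic one-parameter C*-dynamical system,
Condition 4.3 (in its periodic form) is equivalent to Condition (S). -/
theorem condition43Periodic_iff_conditionS (α : ℝ → X → X) (hα : IsCStarDynSys α)
    (γ₁ : ℝ) (hγ₁ : 0 < γ₁) (hper : ∀ x : X, α (2 * Real.pi / γ₁) x = x)
    (hnontrivial : ∃ n : ℤ, n ≠ 0 ∧ specZ α γ₁ n ≠ ({0} : Set X)) :
    Condition43Periodic α γ₁ ↔ ConditionS α γ₁ := by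
  have : Fact (0 < 2 * Real.pi / γ₁) := ⟨by positivity⟩
  exact ⟨conditionS_of_condition43Periodic hα hγ₁ hper,
    condition43Periodic_of_conditionS hα hγ₁ hper hnontrivial⟩

end PeligradMax
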